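/- arXiv:math/0506316 — 2 statements merged into one kernel-verified Lean document; each statement's English description precedes it below -/
import Mathlib

section
/- (Steinitz) Every triangulated surface with Euler characteristic 2 and at least 5 vertices has a contractible edge; equivalently, the boundary of the tetrahedron (the 4-vertex triangulated surface) is the only irreducible triangulation of the 2-sphere. -/
open scoped Classical

/-- A triangulated surface on the vertex set `Fin n`: a finite 2-dimensional simplicial
complex given by its set of triangles, which is connected, in which every vertex lies in
some triangle, every edge lies in exactly two triangles, and the link of every vertex is
a single cycle (encoded as: the link graph of every vertex is connected; together with the
condition that every edge lies in exactly two triangles this makes every vertex link a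
single circle). -/
structure TriSurface (n : ℕ) where
  faces : Finset (Finset (Fin n))
  card_eq : ∀ f ∈ faces, f.card = 3
  vertex_mem : ∀ v : Fin n, ∃ f ∈ faces, v ∈ f
  edge_two : ∀ u v : Fin n, u ≠ v → (∃ f ∈ faces, u ∈ f ∧ v ∈ f) →
      (faces.filter (fun f => u ∈ f ∧ v ∈ f)).card = 2
  conn : ∀ u v : Fin n,
      Relation.ReflTransGen (fun a b : Fin n => ∃ f ∈ faces, a ∈ f ∧ b ∈ f) u v
  link_cycle : ∀ v a b : Fin n,
      (∃ f ∈ faces, v ∈ f ∧ a ∈ f ∧ a ≠ v) →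
      (∃ f ∈ faces, v ∈ f ∧ b ∈ f ∧ b ≠ v) →
      Relation.ReflTransGen
        (fun x y : Fin n => x ≠ y ∧ x ≠ v ∧ y ≠ v ∧ ({v, x, y} : Finset (Fin n)) ∈ faces)
        a b

/-- The edges of a triangulated surface: all 2-element vertex sets contained in a triangle. -/
noncomputable def TriSurface.edges {n : ℕ} (S : TriSurface n) : Finset (Finset (Fin n)) :=
  Finset.univ.filter (fun e => e.card = 2 ∧ ∃ f ∈ S.faces, e ⊆ f)

/-- The Euler characteristic χ = f₀ - f₁ + f₂ of a triangulated surface. -/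
noncomputable def TriSurface.eulerChar {n : ℕ} (S : TriSurface n) : ℤ :=
  (n : ℤ) - (S.edges.card : ℤ) + (S.faces.card : ℤ)

/-- Combinatorial isomorphism: a bijection of the vertices mapping triangles to triangles. -/
def TriSurface.Iso {n : ℕ} (S T : TriSurface n) : Prop :=
  ∃ σ : Equiv.Perm (Fin n), ∀ f : Finset (Fin n), f ∈ S.faces ↔ f.image σ ∈ T.faces

/-- Orientability: each triangle can be given a cyclic orientation (recorded as the set of
its three induced directed edges) such that the two orientations induced on each edge by
the two triangles containing it are opposite (no directed edge is induced twice). -/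
def TriSurface.Orientable {n : ℕ} (S : TriSurface n) : Prop :=
  ∃ ω : Finset (Fin n) → Finset (Fin n × Fin n),
    (∀ f ∈ S.faces, ∃ a b c : Fin n, a ≠ b ∧ a ≠ c ∧ b ≠ c ∧
        f = {a, b, c} ∧ ω f = {(a, b), (b, c), (c, a)}) ∧
    (∀ f ∈ S.faces, ∀ g ∈ S.faces, f ≠ g → ∀ p ∈ ω f, p ∉ ω g)

/-- The edge `uv` is contractible: the only common neighbours of `u` and `v` are the two
vertices `w`, `z` with `uvw`, `uvz` triangles, and the edge `wz` is not contained in both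
the link of `u` and the link of `v`. -/
def TriSurface.Contractible {n : ℕ} (S : TriSurface n) (u v : Fin n) : Prop :=
  ({u, v} : Finset (Fin n)) ∈ S.edges ∧
  (∀ w : Fin n, w ≠ u → w ≠ v →
      ({u, w} : Finset (Fin n)) ∈ S.edges → ({v, w} : Finset (Fin n)) ∈ S.edges →
      ({u, v, w} : Finset (Fin n)) ∈ S.faces) ∧
  ¬ ∃ w z : Fin n, ({u, v, w} : Finset (Fin n)) ∈ S.faces ∧
      ({u, v, z} : Finset (Fin n)) ∈ S.faces ∧ w ≠ z ∧
      ({u, w, z} : Finset (Fin n)) ∈ S.faces ∧ ({v, w, z} : Finset (Fin n)) ∈ S.faces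

/-- A triangulated surface is irreducible if it has no contractible edge. -/
def TriSurface.Irreducible {n : ℕ} (S : TriSurface n) : Prop :=
  ¬ ∃ u v : Fin n, S.Contractible u v

/-- The simplices of the complex: the nonempty subsets of triangles. -/
def TriSurface.IsSimplex {n : ℕ} (S : TriSurface n) (σ : Finset (Fin n)) : Prop :=
  σ.Nonempty ∧ ∃ f ∈ S.faces, σ ⊆ f

/-- A geometric realization in ℝ³: each triangle is mapped to affinely independent points,
and the convex hulls of the point sets of any two simplices of the complex intersect
exactly in the convex hull of the points of their common vertices. -/
def TriSurface.IsRealization {n : ℕ} (S : TriSurface n) (p : Fin n → (Fin 3 → ℝ)) : Prop :=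
  (∀ f ∈ S.faces, AffineIndependent ℝ (fun x : {x // x ∈ f} => p x.1)) ∧
  ∀ σ τ : Finset (Fin n), S.IsSimplex σ → S.IsSimplex τ →
    convexHull ℝ (p '' ↑σ) ∩ convexHull ℝ (p '' ↑τ) = convexHull ℝ (p '' ↑(σ ∩ τ))

/-- Neighborly: every pair of distinct vertices forms an edge. -/
def TriSurface.Neighborly {n : ℕ} (S : TriSurface n) : Prop :=
  ∀ u v : Fin n, u ≠ v → ({u, v} : Finset (Fin n)) ∈ S.edges

namespace TriSurface

variable {n : ℕ} (S : TriSurface n)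

theorem pair_mem_edges {a b : Fin n} :
    ({a, b} : Finset (Fin n)) ∈ S.edges ↔ a ≠ b ∧ ∃ f ∈ S.faces, a ∈ f ∧ b ∈ f := by
  simp [edges, Finset.card_eq_two, Finset.insert_subset_iff]
  intro f _ _ _
  constructor
  · rintro ⟨x, y, hxy, h⟩ rfl
    have := congrArg Finset.card h
    rw [Finset.card_pair hxy] at this
    simp at this
  · intro h
    exact ⟨a, b, h, rfl⟩

theorem exists_pair_of_mem_edges {e : Finset (Fin n)} (he : e ∈ S.edges) :
    ∃ a b, a ≠ b ∧ e = {a, b} := by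
  simp only [edges, Finset.mem_filter] at he
  exact Finset.card_eq_two.mp he.2.1

/-- An edge of a given triangle lies in exactly one further triangle. -/
theorem exists_opposite {a b : Fin n} (hab : a ≠ b) {f : Finset (Fin n)} (hf : f ∈ S.faces)
    (ha : a ∈ f) (hb : b ∈ f) :
    ∃ g ∈ S.faces, a ∈ g ∧ b ∈ g ∧ g ≠ f ∧
      S.faces.filter (fun h => a ∈ h ∧ b ∈ h) = {f, g} := by
  obtain ⟨x, y, hxy, h⟩ := Finset.card_eq_two.mp (S.edge_two a b hab ⟨f, hf, ha, hb⟩)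
  have hx : x ∈ S.faces.filter (fun h => a ∈ h ∧ b ∈ h) := by simp [h]
  have hy : y ∈ S.faces.filter (fun h => a ∈ h ∧ b ∈ h) := by simp [h]
  have hf' : f ∈ S.faces.filter (fun h => a ∈ h ∧ b ∈ h) := by simp [hf, ha, hb]
  rw [h] at hf'
  simp only [Finset.mem_filter] at hx hy
  simp only [Finset.mem_insert, Finset.mem_singleton] at hf'
  rcases hf' with rfl | rfl
  · exact ⟨y, hy.1, hy.2.1, hy.2.2, hxy.symm, h⟩
  · exact ⟨x, hx.1, hx.2.1, hx.2.2, hxy, by rw [h, Finset.pair_comm]⟩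

/-- If two faces sharing an edge at `v` always take the same value, then so do all faces
around `v`. -/
theorem constant_around_vertex {α : Type*} (φ : S.faces → α) (v : Fin n)
    (h : ∀ y, y ≠ v → ∀ f g : S.faces, v ∈ f.1 → y ∈ f.1 → v ∈ g.1 → y ∈ g.1 → φ f = φ g)
    (f g : S.faces) (hf : v ∈ f.1) (hg : v ∈ g.1) : φ f = φ g := by
  have key : ∀ f : S.faces, ∃ a ∈ f.1, a ≠ v := fun f =>
    Finset.exists_mem_ne (by rw [S.card_eq _ f.2]; norm_num) v
  obtain ⟨a, haf, hav⟩ := key f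
  obtain ⟨b, hbg, hbv⟩ := key g
  have path := S.link_cycle v a b ⟨f, f.2, hf, haf, hav⟩ ⟨g, g.2, hg, hbg, hbv⟩
  have : ∀ g : S.faces, v ∈ g.1 → b ∈ g.1 → φ f = φ g := by
    clear hbg hbv
    induction path with
    | refl => exact fun g hg hb => h a hav f g hf haf hg hb
    | @tail x y _ hxy ih =>
      obtain ⟨-, -, hyv, hface⟩ := hxy
      intro g hg hy
      exact (ih ⟨_, hface⟩ (by simp) (by simp)).trans
        (h y hyv _ g (by simp) (by simp) hg hy)
  exact this g hg hbg

/-- If two faces sharing an edge always take the same value, then so do all faces. -/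
theorem constant_of_edge {α : Type*} (φ : S.faces → α)
    (h : ∀ x y, y ≠ x → ∀ f g : S.faces, x ∈ f.1 → y ∈ f.1 → x ∈ g.1 → y ∈ g.1 → φ f = φ g)
    (f g : S.faces) : φ f = φ g := by
  have key : ∀ f : S.faces, ∃ a, a ∈ f.1 := fun f =>
    Finset.card_pos.mp (by rw [S.card_eq _ f.2]; norm_num)
  obtain ⟨a, haf⟩ := key f
  obtain ⟨b, hbg⟩ := key g
  have path := S.conn a b
  have : ∀ g : S.faces, b ∈ g.1 → φ f = φ g := by
    clear hbg
    induction path with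
    | refl => exact fun g hg => S.constant_around_vertex φ a (h a) f g haf hg
    | @tail x y _ hxy ih =>
      obtain ⟨k, hk, hxk, hyk⟩ := hxy
      exact fun g hg => (ih ⟨k, hk⟩ hxk).trans
        (S.constant_around_vertex φ y (h y) ⟨k, hk⟩ g hyk hg)
  exact this g hbg

/-- The boundary operator from triangles to edges modulo 2. -/
noncomputable def boundaryTwo : (S.faces → ZMod 2) →ₗ[ZMod 2] (S.edges → ZMod 2) :=
  Matrix.mulVecLin (Matrix.of fun e f => if e.1 ⊆ f.1 then 1 else 0)

/-- The boundary operator from edges to vertices modulo 2. -/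
noncomputable def boundaryOne : (S.edges → ZMod 2) →ₗ[ZMod 2] (Fin n → ZMod 2) :=
  Matrix.mulVecLin (Matrix.of fun v e => if v ∈ e.1 then 1 else 0)

theorem boundaryTwo_apply (c : S.faces → ZMod 2) {a b : Fin n} {f g : S.faces}
    (hab : a ≠ b) (haf : a ∈ f.1) (hbf : b ∈ f.1) (hag : a ∈ g.1) (hbg : b ∈ g.1)
    (hfg : g ≠ f) (e : S.edges) (he : e.1 = {a, b}) :
    S.boundaryTwo c e = c f + c g := by
  obtain ⟨k, hk, -, -, -, hfil⟩ := S.exists_opposite hab f.2 haf hbf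
  have hgk : g.1 = k := by
    have : g.1 ∈ S.faces.filter (fun h => a ∈ h ∧ b ∈ h) := by
      simp [hag, hbg]
    rw [hfil] at this
    simp only [Finset.mem_insert, Finset.mem_singleton] at this
    exact this.resolve_left fun h => hfg (Subtype.ext h)
  have : (Finset.univ.filter fun h : S.faces => e.1 ⊆ h.1) = {f, g} := by
    ext h
    have := congrArg (h.1 ∈ ·) hfil
    simp only [Finset.mem_filter, h.2, true_and, Finset.mem_insert,
      Finset.mem_singleton, ← hgk, eq_iff_iff] at this
    simp only [Finset.mem_filter, Finset.mem_univ, true_and, he, Finset.insert_subset_iff,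
      Finset.singleton_subset_iff, Finset.mem_insert, Finset.mem_singleton, this,
      Subtype.ext_iff]
  simp only [boundaryTwo, Matrix.mulVecLin_apply, Matrix.mulVec, dotProduct, Matrix.of_apply,
    ite_mul, one_mul, zero_mul]
  rw [← Finset.sum_filter, this, Finset.sum_pair hfg.symm]

theorem boundaryOne_boundaryTwo (c : S.faces → ZMod 2) :
    S.boundaryOne (S.boundaryTwo c) = 0 := by
  simp only [boundaryOne, boundaryTwo, Matrix.mulVecLin_apply, Matrix.mulVec_mulVec]
  refine (congrArg (Matrix.mulVec · c) ?_).trans (Matrix.zero_mulVec c)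
  refine Matrix.ext fun v f => ?_
  simp only [Matrix.mul_apply, Matrix.of_apply, Matrix.zero_apply, ← ite_and, ite_mul, one_mul,
    zero_mul, Finset.sum_boole]
  obtain ⟨f, hf⟩ := f
  have hval : ∀ s : Finset S.edges, s.card = (s.map (Function.Embedding.subtype _)).card :=
    fun s => (Finset.card_map _).symm
  by_cases hv : v ∈ f
  · have hc := S.card_eq f hf
    obtain ⟨x, y, hxy, hxyf⟩ : ∃ x y, x ≠ y ∧ f.erase v = {x, y} :=
      Finset.card_eq_two.mp (by rw [Finset.card_erase_of_mem hv, hc])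
    have hfe : f = {v, x, y} := by rw [← hxyf, Finset.insert_erase hv]
    have hx : x ∈ f.erase v := by simp [hxyf]
    have hy : y ∈ f.erase v := by simp [hxyf]
    simp only [Finset.mem_erase] at hx hy
    have : (Finset.univ.filter fun e : S.edges => v ∈ e.1 ∧ e.1 ⊆ f).map
        (Function.Embedding.subtype _) = {{v, x}, {v, y}} := by
      ext e
      simp only [Finset.mem_map, Finset.mem_filter, Finset.mem_univ, true_and,
        Function.Embedding.subtype_apply, Subtype.exists, exists_and_right, exists_eq_right,
        Finset.mem_insert, Finset.mem_singleton]
      constructor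
      · rintro ⟨⟨he, he1⟩, he2⟩
        obtain ⟨p, q, hpq, rfl⟩ := S.exists_pair_of_mem_edges he
        simp only [hfe, Finset.insert_subset_iff, Finset.singleton_subset_iff, Finset.mem_insert,
          Finset.mem_singleton] at he1 he2
        rcases he1 with rfl | rfl
        · grind
        · rw [Finset.pair_comm p v]
          grind
      · rintro (rfl | rfl)
        · exact ⟨⟨S.pair_mem_edges.mpr ⟨hx.1.symm, f, hf, hv, hx.2⟩, by simp⟩,
            by simp [Finset.insert_subset_iff, hv, hx]⟩
        · exact ⟨⟨S.pair_mem_edges.mpr ⟨hy.1.symm, f, hf, hv, hy.2⟩, by simp⟩,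
            by simp [Finset.insert_subset_iff, hv, hy]⟩
    rw [hval, this, Finset.card_pair]
    · rfl
    · intro h
      have : x ∈ ({v, y} : Finset (Fin n)) := by rw [← h]; simp
      simp [hx.1, hxy] at this
  · rw [Finset.filter_false_of_mem]
    · simp
    · rintro e - ⟨h1, h2⟩
      exact hv (h2 h1)

theorem eq_of_boundaryTwo_eq_zero (c : S.faces → ZMod 2) {a b : Fin n} (hab : a ≠ b)
    (h : ∀ e : S.edges, e.1 = {a, b} → S.boundaryTwo c e = 0) (f g : S.faces)
    (haf : a ∈ f.1) (hbf : b ∈ f.1) (hag : a ∈ g.1) (hbg : b ∈ g.1) : c f = c g := by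
  by_cases hfg : g = f
  · rw [hfg]
  · have := S.boundaryTwo_apply c hab haf hbf hag hbg hfg
      ⟨{a, b}, S.pair_mem_edges.mpr ⟨hab, f, f.2, haf, hbf⟩⟩ rfl
    rw [h _ rfl] at this
    exact CharTwo.add_eq_zero.mp this.symm

theorem constant_of_boundaryTwo_eq_zero (c : S.faces → ZMod 2) (h : S.boundaryTwo c = 0)
    (f g : S.faces) : c f = c g :=
  S.constant_of_edge c (fun x y hxy f g hxf hyf hxg hyg =>
    S.eq_of_boundaryTwo_eq_zero c hxy.symm (fun e _ => by rw [h]; rfl) f g hxf hyf hxg hyg) f g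

theorem finrank_ker_boundaryTwo_le :
    Module.finrank (ZMod 2) (LinearMap.ker S.boundaryTwo) ≤ 1 := by
  have : LinearMap.ker S.boundaryTwo ≤ Submodule.span (ZMod 2) {fun _ => 1} := by
    intro c hc
    rw [Submodule.mem_span_singleton]
    by_cases hne : Nonempty S.faces
    · obtain ⟨f⟩ := hne
      refine ⟨c f, funext fun g => ?_⟩
      simpa using S.constant_of_boundaryTwo_eq_zero c hc f g
    · exact ⟨0, funext fun g => (hne ⟨g⟩).elim⟩
  exact (Submodule.finrank_mono this).trans ((finrank_span_le_card _).trans (by simp))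

theorem boundaryOne_single {a b : Fin n} (hab : a ≠ b) (e : S.edges) (he : e.1 = {a, b}) :
    S.boundaryOne (Pi.single e 1) = Pi.single a 1 + Pi.single b 1 := by
  ext v
  simp only [boundaryOne, Matrix.mulVecLin_apply, Matrix.mulVec_single_one, Matrix.col_apply,
    Matrix.of_apply, he, Finset.mem_insert, Finset.mem_singleton, Pi.add_apply, Pi.single_apply]
  grind

theorem le_finrank_range_boundaryOne (hn : 0 < n) :
    n ≤ Module.finrank (ZMod 2) (LinearMap.range S.boundaryOne) + 1 := by
  set R := LinearMap.range S.boundaryOne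
  set L := Submodule.span (ZMod 2) {(Pi.single (⟨0, hn⟩ : Fin n) 1 : Fin n → ZMod 2)}
  have hall : ∀ v : Fin n, (Pi.single v 1 : Fin n → ZMod 2) ∈ R ⊔ L := by
    intro v
    induction S.conn ⟨0, hn⟩ v with
    | refl => exact Submodule.mem_sup_right (Submodule.mem_span_singleton_self _)
    | @tail x y _ hxy ih =>
      obtain ⟨f, hf, hx, hy⟩ := hxy
      by_cases hne : x = y
      · rwa [← hne]
      · have hmem : (Pi.single x 1 + Pi.single y 1 : Fin n → ZMod 2) ∈ R ⊔ L := by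
          refine Submodule.mem_sup_left ⟨Pi.single ⟨{x, y}, ?_⟩ 1, ?_⟩
          · exact S.pair_mem_edges.mpr ⟨hne, f, hf, hx, hy⟩
          · exact S.boundaryOne_single hne _ rfl
        simpa using sub_mem hmem ih
  have htop : R ⊔ L = ⊤ := by
    rw [eq_top_iff]
    intro z _
    rw [pi_eq_sum_univ' z]
    refine sum_mem fun v _ => Submodule.smul_mem _ _ ?_
    convert hall v using 1
  have h1 := Submodule.finrank_add_le_finrank_add_finrank R L
  have h2 : Module.finrank (ZMod 2) L ≤ 1 := (finrank_span_le_card _).trans (by simp)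
  rw [htop, finrank_top, Module.finrank_fintype_fun_eq_card, Fintype.card_fin] at h1
  omega

/-- The first homology modulo 2 vanishes for Euler characteristic 2. -/
theorem exists_boundaryTwo_eq (hχ : S.eulerChar = 2) (hn : 0 < n) (z : S.edges → ZMod 2)
    (hz : S.boundaryOne z = 0) : ∃ c, S.boundaryTwo c = z := by
  have hle : LinearMap.range S.boundaryTwo ≤ LinearMap.ker S.boundaryOne := by
    rintro _ ⟨c, rfl⟩
    exact S.boundaryOne_boundaryTwo c
  have h1 := LinearMap.finrank_range_add_finrank_ker S.boundaryOne
  have h2 := LinearMap.finrank_range_add_finrank_ker S.boundaryTwo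
  have h3 := S.finrank_ker_boundaryTwo_le
  have h4 := S.le_finrank_range_boundaryOne hn
  rw [Module.finrank_fintype_fun_eq_card, Fintype.card_coe] at h1 h2
  unfold eulerChar at hχ
  have heq := Submodule.eq_of_le_of_finrank_le hle (by omega)
  have : z ∈ LinearMap.range S.boundaryTwo := by rw [heq]; exact hz
  exact this

/-- The chain of edges contained in `C`. -/
noncomputable def edgeChain (C : Finset (Fin n)) : S.edges → ZMod 2 :=
  fun e => if e.1 ⊆ C then 1 else 0

/-- A missing triangle: its three edges are present, but it is not a face. -/
def Missing (u v w : Fin n) : Prop :=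
  ({u, v} : Finset (Fin n)) ∈ S.edges ∧ ({u, w} : Finset (Fin n)) ∈ S.edges ∧
    ({v, w} : Finset (Fin n)) ∈ S.edges ∧ ({u, v, w} : Finset (Fin n)) ∉ S.faces

variable {S}

theorem pair_eq_of_subset {a b u v w : Fin n} (hab : a ≠ b)
    (h : ({a, b} : Finset (Fin n)) ⊆ {u, v, w}) :
    ({a, b} : Finset (Fin n)) = {u, v} ∨ ({a, b} : Finset (Fin n)) = {u, w} ∨
      ({a, b} : Finset (Fin n)) = {v, w} := by
  simp only [Finset.insert_subset_iff, Finset.singleton_subset_iff, Finset.mem_insert,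
    Finset.mem_singleton] at h
  rcases h with ⟨rfl | rfl | rfl, rfl | rfl | rfl⟩ <;> simp_all [Finset.pair_comm]

/-- A chain supported on a triangle of edges is the sum of its values on these edges. -/
theorem eq_sum_of_support {u v w : Fin n} (h : S.Missing u v w) (z : S.edges → ZMod 2)
    (hz : ∀ e : S.edges, ¬ e.1 ⊆ {u, v, w} → z e = 0) :
    z = z ⟨_, h.1⟩ • Pi.single ⟨_, h.1⟩ 1 + z ⟨_, h.2.1⟩ • Pi.single ⟨_, h.2.1⟩ 1 +
      z ⟨_, h.2.2.1⟩ • Pi.single ⟨_, h.2.2.1⟩ 1 := by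
  have huv := (S.pair_mem_edges.mp h.1).1
  have huw := (S.pair_mem_edges.mp h.2.1).1
  have hvw := (S.pair_mem_edges.mp h.2.2.1).1
  have h1 : ({u, v} : Finset (Fin n)) ≠ {u, w} := fun h => by
    have : v ∈ ({u, w} : Finset (Fin n)) := by rw [← h]; simp
    simp [huv.symm, hvw] at this
  have h2 : ({u, v} : Finset (Fin n)) ≠ {v, w} := fun h => by
    have : u ∈ ({v, w} : Finset (Fin n)) := by rw [← h]; simp
    simp [huv, huw] at this
  have h3 : ({u, w} : Finset (Fin n)) ≠ {v, w} := fun h => by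
    have : u ∈ ({v, w} : Finset (Fin n)) := by rw [← h]; simp
    simp [huv, huw] at this
  ext e
  obtain ⟨e, he⟩ := e
  simp only [Pi.add_apply, Pi.smul_apply, Pi.single_apply, smul_eq_mul, Subtype.mk.injEq]
  by_cases hs : e ⊆ {u, v, w}
  · obtain ⟨a, b, hab, rfl⟩ := S.exists_pair_of_mem_edges he
    rcases pair_eq_of_subset hab hs with hh | hh | hh
    · simp [hh, h1, h2]
    · simp [hh, h1.symm, h3]
    · simp [hh, h2.symm, h3.symm]
  · rw [hz ⟨e, he⟩ hs]
    have e1 : e ≠ {u, v} := by rintro rfl; exact hs (by simp [Finset.insert_subset_iff])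
    have e2 : e ≠ {u, w} := by rintro rfl; exact hs (by simp [Finset.insert_subset_iff])
    have e3 : e ≠ {v, w} := by rintro rfl; exact hs (by simp)
    simp [e1, e2, e3]

theorem boundaryOne_of_support {u v w : Fin n} (h : S.Missing u v w) (z : S.edges → ZMod 2)
    (hz : ∀ e : S.edges, ¬ e.1 ⊆ {u, v, w} → z e = 0) :
    S.boundaryOne z = z ⟨_, h.1⟩ • (Pi.single u 1 + Pi.single v 1) +
      z ⟨_, h.2.1⟩ • (Pi.single u 1 + Pi.single w 1) +
      z ⟨_, h.2.2.1⟩ • (Pi.single v 1 + Pi.single w 1) := by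
  conv_lhs => rw [eq_sum_of_support h z hz]
  simp only [map_add, map_smul]
  rw [S.boundaryOne_single (S.pair_mem_edges.mp h.1).1 _ rfl,
    S.boundaryOne_single (S.pair_mem_edges.mp h.2.1).1 _ rfl,
    S.boundaryOne_single (S.pair_mem_edges.mp h.2.2.1).1 _ rfl]

theorem boundaryOne_edgeChain {u v w : Fin n} (h : S.Missing u v w) :
    S.boundaryOne (S.edgeChain {u, v, w}) = 0 := by
  rw [boundaryOne_of_support h _ fun e he => by simp [edgeChain, he]]
  have hs : ({u, v} : Finset (Fin n)) ⊆ {u, v, w} ∧ ({u, w} : Finset (Fin n)) ⊆ {u, v, w} ∧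
      ({v, w} : Finset (Fin n)) ⊆ {u, v, w} := by simp [Finset.insert_subset_iff]
  ext x
  simp only [edgeChain, hs.1, hs.2.1, hs.2.2, if_true, one_smul, Pi.add_apply, Pi.zero_apply]
  generalize (Pi.single u 1 : Fin n → ZMod 2) x = p
  generalize (Pi.single v 1 : Fin n → ZMod 2) x = q
  generalize (Pi.single w 1 : Fin n → ZMod 2) x = r
  revert p q r
  decide

/-- A cycle supported on a triangle of edges is a multiple of that triangle. -/
theorem eq_smul_edgeChain {u v w : Fin n} (h : S.Missing u v w) (z : S.edges → ZMod 2)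
    (hz : ∀ e : S.edges, ¬ e.1 ⊆ {u, v, w} → z e = 0) (hz0 : S.boundaryOne z = 0) :
    z = 0 ∨ z = S.edgeChain {u, v, w} := by
  have huv := (S.pair_mem_edges.mp h.1).1
  have huw := (S.pair_mem_edges.mp h.2.1).1
  have hvw := (S.pair_mem_edges.mp h.2.2.1).1
  have hb := boundaryOne_of_support h z hz
  rw [hz0] at hb
  have hu := congrFun hb u
  have hv := congrFun hb v
  simp [huv, huw, hvw, huv.symm] at hu hv
  have h1 := CharTwo.add_eq_zero.mp hu.symm
  have h2 := CharTwo.add_eq_zero.mp hv.symm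
  have hval : ∀ e : S.edges, e.1 ⊆ {u, v, w} → z e = z ⟨_, h.1⟩ := by
    rintro ⟨e, he⟩ hs
    obtain ⟨a, b, hab, rfl⟩ := S.exists_pair_of_mem_edges he
    rcases pair_eq_of_subset hab hs with hh | hh | hh
    · simp only [hh]
    · simp only [hh, h1]
    · simp only [hh, h2]
  have hcases : ∀ t : ZMod 2, t = 0 ∨ t = 1 := by decide
  rcases hcases (z ⟨_, h.1⟩) with ht | ht
  · left
    ext e
    by_cases hs : e.1 ⊆ {u, v, w}
    · rw [hval e hs, ht]; rfl
    · rw [hz e hs]; rfl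
  · right
    ext e
    by_cases hs : e.1 ⊆ {u, v, w}
    · rw [hval e hs, ht]; simp [edgeChain, hs]
    · rw [hz e hs]; simp [edgeChain, hs]

/-- A surface containing the boundary of a tetrahedron has at most four vertices. -/
theorem card_le_four_of_tetrahedron {a b c d : Fin n}
    (habc : ({a, b, c} : Finset (Fin n)) ∈ S.faces)
    (habd : ({a, b, d} : Finset (Fin n)) ∈ S.faces) (hacd : ({a, c, d} : Finset (Fin n)) ∈ S.faces)
    (hbcd : ({b, c, d} : Finset (Fin n)) ∈ S.faces) (hcd : c ≠ d) : n ≤ 4 := by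
  set T : Finset (Fin n) := {a, b, c, d} with hT
  have hab : a ≠ b := by
    rintro rfl
    have := S.card_eq _ habc
    have := Finset.card_le_two (a := a) (b := c)
    simp_all
  have hac : a ≠ c := by
    rintro rfl
    have := S.card_eq _ hacd
    have := Finset.card_le_two (a := a) (b := d)
    simp_all
  have had : a ≠ d := by
    rintro rfl
    have := S.card_eq _ hacd
    have := Finset.card_le_two (a := c) (b := a)
    simp_all
  have hbc : b ≠ c := by
    rintro rfl
    have := S.card_eq _ hbcd
    have := Finset.card_le_two (a := b) (b := d)
    simp_all
  have hbd : b ≠ d := by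
    rintro rfl
    have := S.card_eq _ hbcd
    have := Finset.card_le_two (a := c) (b := b)
    simp_all
  have hTc : T.card = 4 := by simp [hT, hab, hac, had, hbc, hbd, hcd]
  have hsub : ∀ t ∈ T, T.erase t ∈ S.faces := by
    intro t ht
    simp only [hT, Finset.mem_insert, Finset.mem_singleton] at ht
    rcases ht with rfl | rfl | rfl | rfl
    · convert hbcd using 1; grind
    · convert hacd using 1; grind
    · convert habd using 1; grind
    · convert habc using 1; grind
  have step : ∀ x y, y ≠ x → ∀ f g : S.faces, x ∈ f.1 → y ∈ f.1 → x ∈ g.1 → y ∈ g.1 →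
      f.1 ⊆ T → g.1 ⊆ T := by
    intro x y hyx f g hxf hyf hxg hyg hf
    have hxT := hf hxf
    have hyT := hf hyf
    obtain ⟨p, q, hpq, hTpq⟩ : ∃ p q, p ≠ q ∧ T \ {x, y} = {p, q} := by
      apply Finset.card_eq_two.mp
      rw [Finset.card_sdiff_of_subset (by simp [Finset.insert_subset_iff, hxT, hyT]), hTc,
        Finset.card_pair hyx.symm]
    have hp : p ∈ T \ {x, y} := by simp [hTpq]
    have hq : q ∈ T \ {x, y} := by simp [hTpq]
    simp only [Finset.mem_sdiff, Finset.mem_insert, Finset.mem_singleton, not_or] at hp hq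
    have hpf := hsub p hp.1
    obtain ⟨k, -, -, -, -, hfil⟩ := S.exists_opposite hyx.symm hpf
      (by simp [hxT, Ne.symm hp.2.1]) (by simp [hyT, Ne.symm hp.2.2])
    have hqm : T.erase q ∈ S.faces.filter (fun h => x ∈ h ∧ y ∈ h) := by
      simp [hsub q hq.1, hxT, hyT, Ne.symm hq.2.1, Ne.symm hq.2.2]
    have hgm : g.1 ∈ S.faces.filter (fun h => x ∈ h ∧ y ∈ h) := by simp [hxg, hyg]
    rw [hfil, Finset.mem_insert, Finset.mem_singleton] at hqm hgm
    have hqk : T.erase q = k := hqm.resolve_left fun h => by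
      have : p ∈ T.erase p := by rw [← h]; simp [hpq, hp.1]
      simp at this
    rcases hgm with h | h
    · rw [h]; exact Finset.erase_subset _ _
    · rw [h, ← hqk]; exact Finset.erase_subset _ _
  have hall : ∀ v : Fin n, v ∈ T := by
    intro v
    obtain ⟨f, hf, hv⟩ := S.vertex_mem v
    have := S.constant_of_edge (fun f => f.1 ⊆ T)
      (fun x y hyx f g h1 h2 h3 h4 => propext
        ⟨step x y hyx f g h1 h2 h3 h4, step x y hyx g f h3 h4 h1 h2⟩)
      ⟨_, habc⟩ ⟨f, hf⟩
    have hfT : f ⊆ T := this.mp (by intro x; simp [hT]; tauto)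
    exact hfT hv
  have : T = Finset.univ := Finset.eq_univ_iff_forall.mpr hall
  rw [this, Finset.card_univ, Fintype.card_fin] at hTc
  exact hTc.le

theorem exists_missing_of_not_contractible (hn : 5 ≤ n) {u v : Fin n}
    (huv : ({u, v} : Finset (Fin n)) ∈ S.edges) (h : ¬ S.Contractible u v) :
    ∃ w, S.Missing u v w := by
  by_contra hno
  refine h ⟨huv, fun w _ _ h1 h2 => ?_, ?_⟩
  · by_contra hf
    exact hno ⟨w, huv, h1, h2, hf⟩
  · rintro ⟨w, z, h1, h2, hwz, h3, h4⟩
    have := card_le_four_of_tetrahedron h1 h2 h3 h4 hwz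
    omega

/-- If the chain `c` bounds a missing triangle through `uv` and no edge is contractible, then
some other missing triangle bounds a chain of strictly smaller support. -/
theorem exists_smaller_chain (hχ : S.eulerChar = 2) (hn : 5 ≤ n)
    (hirr : ∀ u v, ¬ S.Contractible u v) {u v w : Fin n} (h : S.Missing u v w)
    (c : S.faces → ZMod 2) (hc : S.boundaryTwo c = S.edgeChain {u, v, w}) :
    ∃ u' v' w', S.Missing u' v' w' ∧ ∃ c', S.boundaryTwo c' = S.edgeChain {u', v', w'} ∧
      (Finset.univ.filter fun f => c' f ≠ 0) ⊂ (Finset.univ.filter fun f => c f ≠ 0) := by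
  have hcases : ∀ t : ZMod 2, t = 0 ∨ t = 1 := by decide
  set C : Finset (Fin n) := {u, v, w} with hC
  obtain ⟨huv, f₀, hf₀, hu₀, hv₀⟩ := S.pair_mem_edges.mp h.1
  obtain ⟨f, huf, hvf, hcf⟩ : ∃ f : S.faces, u ∈ f.1 ∧ v ∈ f.1 ∧ c f = 1 := by
    obtain ⟨g₀, hg₀, hug, hvg, hne, -⟩ := S.exists_opposite huv hf₀ hu₀ hv₀
    have := S.boundaryTwo_apply c (f := ⟨f₀, hf₀⟩) (g := ⟨g₀, hg₀⟩) huv hu₀ hv₀ hug hvg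
      (by simpa using hne) ⟨_, h.1⟩ rfl
    have h1 : S.edgeChain C ⟨_, h.1⟩ = 1 := by
      simp [edgeChain, hC, Finset.insert_subset_iff]
    rw [hc, h1] at this
    rcases hcases (c ⟨f₀, hf₀⟩) with h0 | h0
    · rw [h0, zero_add] at this
      exact ⟨⟨g₀, hg₀⟩, hug, hvg, this.symm⟩
    · exact ⟨_, hu₀, hv₀, h0⟩
  obtain ⟨x, hxf, hxC⟩ : ∃ x ∈ f.1, x ∉ C := by
    by_contra! hsub
    have hCf : f.1 = C := Finset.eq_of_subset_of_card_le hsub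
      (by rw [S.card_eq _ f.2]; exact Finset.card_le_three)
    have hf := f.2
    rw [hCf] at hf
    exact h.2.2.2 hf
  have hinner : ∀ x, x ∉ C → ∀ f g : S.faces, x ∈ f.1 → x ∈ g.1 → c f = c g := by
    intro x hx
    refine S.constant_around_vertex c x fun y hy f g h1 h2 h3 h4 => ?_
    refine S.eq_of_boundaryTwo_eq_zero c hy.symm (fun e he => ?_) f g h1 h2 h3 h4
    rw [hc, edgeChain, if_neg]
    rw [he, Finset.insert_subset_iff]
    exact fun h => hx h.1
  have hux : u ≠ x := by rintro rfl; exact hxC (by simp [hC])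
  have huxe : ({u, x} : Finset (Fin n)) ∈ S.edges :=
    S.pair_mem_edges.mpr ⟨hux, f, f.2, huf, hxf⟩
  obtain ⟨y, hm⟩ := exists_missing_of_not_contractible hn huxe (hirr u x)
  obtain ⟨c', hc'⟩ := S.exists_boundaryTwo_eq hχ (by omega) _ (boundaryOne_edgeChain hm)
  have hd : ∀ e : S.edges, ¬ e.1 ⊆ {u, v, w} → S.boundaryTwo (c' * (1 + c)) e = 0 := by
    rintro ⟨e, he⟩ heC
    obtain ⟨a, b, hab, rfl⟩ := S.exists_pair_of_mem_edges he
    obtain ⟨-, k, hk, hak, hbk⟩ := S.pair_mem_edges.mp he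
    obtain ⟨l, hl, hal, hbl, hne, -⟩ := S.exists_opposite hab hk hak hbk
    have hbd := fun c => S.boundaryTwo_apply c (f := ⟨k, hk⟩) (g := ⟨l, hl⟩) hab hak hbk hal hbl
      (by simpa using hne) ⟨_, he⟩ rfl
    have hkl : c ⟨k, hk⟩ = c ⟨l, hl⟩ := by
      have := hbd c
      rw [hc, edgeChain, if_neg heC] at this
      exact CharTwo.add_eq_zero.mp this.symm
    rw [hbd]
    simp only [Pi.mul_apply, Pi.add_apply, Pi.one_apply, ← hkl, ← add_mul]
    rcases hcases (c ⟨k, hk⟩) with h0 | h0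
    · rw [← hbd, hc', edgeChain, if_neg, zero_mul]
      intro hs
      have hx1 : ∀ g : S.faces, x ∈ g.1 → c g = 1 := fun g hg =>
        (hinner x hxC g f hg hxf).trans hcf
      have hxk : x ∉ k := fun hx => by
        have := hx1 ⟨k, hk⟩ hx
        rw [h0] at this
        exact zero_ne_one this
      have key : ({a, b} : Finset (Fin n)) = {u, y} := by
        rcases pair_eq_of_subset hab hs with hh | hh | hh
        · exfalso
          have : x ∈ ({a, b} : Finset (Fin n)) := by rw [hh]; simp
          simp only [Finset.mem_insert, Finset.mem_singleton] at this
          rcases this with rfl | rfl <;> exact hxk ‹_›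
        · exact hh
        · exfalso
          have : x ∈ ({a, b} : Finset (Fin n)) := by rw [hh]; simp
          simp only [Finset.mem_insert, Finset.mem_singleton] at this
          rcases this with rfl | rfl <;> exact hxk ‹_›
      have hyk : y ∈ k := by
        have : y ∈ ({a, b} : Finset (Fin n)) := by rw [key]; simp
        simp only [Finset.mem_insert, Finset.mem_singleton] at this
        rcases this with rfl | rfl <;> assumption
      have hyC : y ∉ C := fun hy => heC (by
        show ({a, b} : Finset (Fin n)) ⊆ C
        rw [key]
        simp only [Finset.insert_subset_iff, Finset.singleton_subset_iff]
        exact ⟨by simp [hC], hy⟩)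
      obtain ⟨-, g, hg, hxg, hyg⟩ := S.pair_mem_edges.mp hm.2.2.1
      have := (hinner y hyC ⟨k, hk⟩ ⟨g, hg⟩ hyk hyg).trans (hx1 _ hxg)
      rw [h0] at this
      exact zero_ne_one this
    · rw [h0, CharTwo.add_self_eq_zero, mul_zero]
  obtain ⟨c'', hc'', hle⟩ : ∃ c'', S.boundaryTwo c'' = S.edgeChain {u, x, y} ∧
      ∀ g, c g = 0 → c'' g = 0 := by
    rcases eq_smul_edgeChain h _ hd (S.boundaryOne_boundaryTwo _) with h0 | h0
    · refine ⟨c', hc', fun g hg => ?_⟩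
      have := S.constant_of_boundaryTwo_eq_zero _ h0 g f
      simpa [hg, hcf, CharTwo.add_self_eq_zero] using this
    · have h1 : S.boundaryTwo (c' * (1 + c) + c) = 0 := by
        rw [map_add, h0, hc]
        ext e
        exact CharTwo.add_self_eq_zero _
      have hone : ∀ e, S.boundaryTwo 1 e = 0 := by
        rintro ⟨e, he⟩
        obtain ⟨a, b, hab, rfl⟩ := S.exists_pair_of_mem_edges he
        obtain ⟨-, k, hk, hak, hbk⟩ := S.pair_mem_edges.mp he
        obtain ⟨l, hl, hal, hbl, hne, -⟩ := S.exists_opposite hab hk hak hbk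
        rw [S.boundaryTwo_apply 1 (f := ⟨k, hk⟩) (g := ⟨l, hl⟩) hab hak hbk hal hbl
          (by simpa using hne) ⟨_, he⟩ rfl]
        exact CharTwo.add_self_eq_zero _
      refine ⟨c' + 1, ?_, fun g hg => ?_⟩
      · rw [map_add, hc']
        ext e
        simp [hone]
      · have := S.constant_of_boundaryTwo_eq_zero _ h1 g f
        simp only [Pi.add_apply, Pi.mul_apply, Pi.one_apply, hg, hcf, add_zero, mul_one,
          CharTwo.add_self_eq_zero, mul_zero, zero_add] at this
        simp [this, CharTwo.add_self_eq_zero]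
  refine ⟨u, x, y, hm, c'', hc'', ?_⟩
  rw [Finset.ssubset_iff_subset_ne]
  constructor
  · intro g
    simp only [Finset.mem_filter, Finset.mem_univ, true_and]
    exact mt (hle g)
  · intro heq
    have hcc : c'' = c := by
      ext g
      have := congrArg (g ∈ ·) heq
      simp only [Finset.mem_filter, Finset.mem_univ, true_and, eq_iff_iff] at this
      rcases hcases (c g) with h1 | h1 <;> rcases hcases (c'' g) with h2 | h2 <;>
        simp_all
    have := congrFun (hc''.symm.trans (hcc ▸ hc)) ⟨_, huxe⟩
    simp [edgeChain, Finset.insert_subset_iff, hxC] at this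

end TriSurface

/-- Steinitz: every triangulated surface with Euler characteristic 2 and at least
5 vertices has a contractible edge (so the boundary of the tetrahedron is the only
irreducible triangulation of the 2-sphere). -/
theorem steinitz_sphere_contractible_edge {n : ℕ} (S : TriSurface n)
    (hχ : S.eulerChar = 2) (hn : 5 ≤ n) :
    ∃ u v : Fin n, S.Contractible u v := by
  by_contra! hirr
  have hnone : ∀ (k : ℕ) (u v w : Fin n), S.Missing u v w → ∀ c : S.faces → ZMod 2,
      S.boundaryTwo c = S.edgeChain {u, v, w} →
      (Finset.univ.filter fun f => c f ≠ 0).card = k → False := by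
    intro k
    induction k using Nat.strong_induction_on with
    | _ k ih =>
      intro u v w h c hc hk
      obtain ⟨u', v', w', h', c', hc', hlt⟩ :=
        TriSurface.exists_smaller_chain hχ hn hirr h c hc
      exact ih _ (hk ▸ Finset.card_lt_card hlt) u' v' w' h' c' hc' rfl
  obtain ⟨f, hf, hu⟩ := S.vertex_mem ⟨0, by omega⟩
  obtain ⟨v, hv, hvu⟩ := Finset.exists_mem_ne (by rw [S.card_eq f hf]; norm_num)
    (⟨0, by omega⟩ : Fin n)
  obtain ⟨w, hm⟩ := TriSurface.exists_missing_of_not_contractible hn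
    (S.pair_mem_edges.mpr ⟨hvu.symm, f, hf, hu, hv⟩) (hirr _ v)
  obtain ⟨c, hc⟩ := S.exists_boundaryTwo_eq hχ (by omega) _ (TriSurface.boundaryOne_edgeChain hm)
  exact hnone _ _ _ _ hm c hc rfl
end

section
/- (Barnette–Edelson) For every integer χ ≤ 2 and each orientability class, there are only finitely many combinatorial isomorphism classes of irreducible triangulated surfaces with Euler characteristic χ and that orientability; i.e., every 2-manifold has only finitely many irreducible triangulations. -/
open scoped Classical

namespace TriSurface

variable {n : ℕ}

/-- The simplicial coboundary over `ZMod 2` of a function on edges, evaluated at `t`. -/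
def coboundary (q : Finset (Fin n) → ZMod 2) (t : Finset (Fin n)) : ZMod 2 :=
  ∑ e ∈ t.powersetCard 2, q e

lemma powersetCard_two_triple {x y z : Fin n} (hxy : x ≠ y) (hxz : x ≠ z) (hyz : y ≠ z) :
    ({x, y, z} : Finset (Fin n)).powersetCard 2 = {{x, y}, {x, z}, {y, z}} := by
  symm
  apply Finset.eq_of_subset_of_card_le
  · intro e he
    simp only [Finset.mem_insert, Finset.mem_singleton] at he
    rw [Finset.mem_powersetCard]
    rcases he with rfl | rfl | rfl
    · exact ⟨by grind, Finset.card_pair hxy⟩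
    · exact ⟨by grind, Finset.card_pair hxz⟩
    · exact ⟨by grind, Finset.card_pair hyz⟩
  · rw [Finset.card_powersetCard, Finset.card_eq_three.2 ⟨x, y, z, hxy, hxz, hyz, rfl⟩]
    refine le_of_eq (Eq.symm (Finset.card_eq_three.2 ⟨_, _, _, ?_, ?_, ?_, rfl⟩)) <;>
    · intro h
      have h1 := Finset.ext_iff.1 h x
      have h2 := Finset.ext_iff.1 h y
      simp only [Finset.mem_insert, Finset.mem_singleton] at h1 h2
      grind

lemma coboundary_triple (q : Finset (Fin n) → ZMod 2) {x y z : Fin n}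
    (hxy : x ≠ y) (hxz : x ≠ z) (hyz : y ≠ z) :
    coboundary q {x, y, z} = q {x, y} + q {x, z} + q {y, z} := by
  rw [coboundary, powersetCard_two_triple hxy hxz hyz, Finset.sum_insert, Finset.sum_insert,
    Finset.sum_singleton, add_assoc]
  · intro h
    have h1 := Finset.ext_iff.1 (Finset.mem_singleton.1 h) x
    simp only [Finset.mem_insert, Finset.mem_singleton] at h1
    grind
  · intro h
    rw [Finset.mem_insert, Finset.mem_singleton] at h
    rcases h with h | h
    · have h1 := Finset.ext_iff.1 h y
      simp only [Finset.mem_insert, Finset.mem_singleton] at h1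
      grind
    · have h1 := Finset.ext_iff.1 h x
      simp only [Finset.mem_insert, Finset.mem_singleton] at h1
      grind

lemma coboundary_add (p q : Finset (Fin n) → ZMod 2) (t : Finset (Fin n)) :
    coboundary (p + q) t = coboundary p t + coboundary q t := by
  simp [coboundary, Finset.sum_add_distrib]

variable (S : TriSurface n)

lemma mem_edges_pair {u v : Fin n} (huv : u ≠ v) :
    ({u, v} : Finset (Fin n)) ∈ S.edges ↔ ∃ f ∈ S.faces, u ∈ f ∧ v ∈ f := by
  simp [edges, Finset.card_pair huv, Finset.insert_subset_iff]

lemma powersetCard_two_subset_edges {f : Finset (Fin n)} (hf : f ∈ S.faces) :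
    f.powersetCard 2 ⊆ S.edges := by
  intro e he
  rw [Finset.mem_powersetCard] at he
  simpa [edges] using ⟨he.2, f, hf, he.1⟩

/-- Incidence between edges and vertex sets, used as the matrix of the coboundary. -/
noncomputable def incidence (t : Finset (Fin n)) (e : S.edges) : ZMod 2 :=
  if e.1 ⊆ t then 1 else 0

lemma sum_incidence {t : Finset (Fin n)} (ht : t.powersetCard 2 ⊆ S.edges)
    (q : Finset (Fin n) → ZMod 2) :
    ∑ e : S.edges, S.incidence t e * q e.1 = coboundary q t := by
  simp only [incidence]
  rw [Finset.sum_coe_sort S.edges (fun e => (if e ⊆ t then 1 else 0) * q e)]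
  simp only [ite_mul, one_mul, zero_mul]
  rw [← Finset.sum_filter, coboundary]
  congr 1
  ext e
  rw [Finset.mem_filter, Finset.mem_powersetCard]
  constructor
  · rintro ⟨h1, h2⟩
    exact ⟨h2, by simp [edges] at h1; exact h1.1⟩
  · intro h
    exact ⟨ht (Finset.mem_powersetCard.2 h), h.1⟩

/-- The coboundary of a function on vertices. -/
def vertexCoboundary : (Fin n → ZMod 2) →ₗ[ZMod 2] (S.edges → ZMod 2) where
  toFun f e := ∑ x ∈ e.1, f x
  map_add' f g := by ext e; simp [Finset.sum_add_distrib]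
  map_smul' c f := by ext e; simp [Finset.mul_sum]

lemma zmod_two_eq_of_add_eq_zero {a b : ZMod 2} (h : a + b = 0) : a = b := by
  revert a b; decide

lemma le_finrank_range_vertexCoboundary :
    n ≤ Module.finrank (ZMod 2) (LinearMap.range S.vertexCoboundary) + 1 := by
  have h := LinearMap.finrank_range_add_finrank_ker S.vertexCoboundary
  rw [Module.finrank_fin_fun] at h
  have hk : Module.finrank (ZMod 2) (LinearMap.ker S.vertexCoboundary) ≤ 1 := by
    refine finrank_le_one ⟨fun _ => 1, ?_⟩ ?_
    · rw [LinearMap.mem_ker]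
      ext e
      have he : e.1.card = 2 := by have := e.2; simp [edges] at this; exact this.1
      simp only [vertexCoboundary, LinearMap.coe_mk, AddHom.coe_mk, Finset.sum_const, he,
        Pi.zero_apply]
      rfl
    · rintro ⟨g, hg⟩
      have hconst : ∀ u v, g u = g v := by
        intro u v
        induction S.conn u v with
        | refl => rfl
        | @tail b c _ hbc ih =>
          rw [ih]
          by_cases hne : b = c
          · rw [hne]
          · have := congrFun (LinearMap.mem_ker.1 hg) ⟨{b, c}, (S.mem_edges_pair hne).2 hbc⟩
            simp only [vertexCoboundary, LinearMap.coe_mk, AddHom.coe_mk,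
              Finset.sum_pair hne, Pi.zero_apply] at this
            exact zmod_two_eq_of_add_eq_zero this
      rcases isEmpty_or_nonempty (Fin n) with hn | ⟨⟨u⟩⟩
      · exact ⟨0, Subtype.ext (funext fun x => hn.elim x)⟩
      · refine ⟨g u, Subtype.ext (funext fun x => ?_)⟩
        simp [hconst x u]
  omega

/-- The matrix of the coboundary from edges to faces. -/
noncomputable def faceMatrix : Matrix S.faces S.edges (ZMod 2) :=
  Matrix.of fun f e => S.incidence f.1 e

lemma exists_face_pair {u v : Fin n} (huv : u ≠ v) (h : ∃ f ∈ S.faces, u ∈ f ∧ v ∈ f) :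
    ∃ f g, f ≠ g ∧ ∀ t, (t ∈ S.faces ∧ u ∈ t ∧ v ∈ t) ↔ t = f ∨ t = g := by
  obtain ⟨f, g, hfg, hS⟩ := Finset.card_eq_two.1 (S.edge_two u v huv h)
  refine ⟨f, g, hfg, fun t => ?_⟩
  have := Finset.ext_iff.1 hS t
  simpa using this

lemma exists_mem_ne {f : Finset (Fin n)} (hf : f ∈ S.faces) (x : Fin n) : ∃ y ∈ f, y ≠ x :=
  Finset.exists_mem_ne (by rw [S.card_eq f hf]; norm_num) x

/-- The faces around a vertex are connected through faces sharing an edge at that vertex. -/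
lemma star_induction (x : Fin n) {R : Finset (Fin n) → Finset (Fin n) → Prop}
    (hadj : ∀ f ∈ S.faces, ∀ g ∈ S.faces, ∀ y, y ≠ x → x ∈ f → y ∈ f → x ∈ g → y ∈ g → R f g)
    (htrans : ∀ f, ∀ g ∈ S.faces, ∀ h, R f g → R g h → R f h)
    {f g : Finset (Fin n)} (hf : f ∈ S.faces) (hg : g ∈ S.faces) (hxf : x ∈ f) (hxg : x ∈ g) :
    R f g := by
  obtain ⟨a, haf, hax⟩ := S.exists_mem_ne hf x
  obtain ⟨b, hbg, hbx⟩ := S.exists_mem_ne hg x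
  have hpath := S.link_cycle x a b ⟨f, hf, hxf, haf, hax⟩ ⟨g, hg, hxg, hbg, hbx⟩
  clear hbx
  induction hpath generalizing g with
  | refl => exact hadj f hf g hg a hax hxf haf hxg hbg
  | @tail c d _ hcd ih =>
    obtain ⟨-, hc, hd, hface⟩ := hcd
    exact htrans _ _ hface _ (ih hface (by simp) (by simp))
      (hadj _ hface g hg d hd (by simp) (by simp) hxg hbg)

lemma faces_card_le_rank_add_one : S.faces.card ≤ S.faceMatrix.rank + 1 := by
  rw [← Matrix.rank_transpose, Matrix.rank]
  have h := LinearMap.finrank_range_add_finrank_ker S.faceMatrix.transpose.mulVecLin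
  rw [Module.finrank_fintype_fun_eq_card, Fintype.card_coe] at h
  suffices hk : Module.finrank (ZMod 2)
      (LinearMap.ker S.faceMatrix.transpose.mulVecLin) ≤ 1 by omega
  have hsum : ∀ (g : S.faces → ZMod 2) (u v : Fin n) (huv : u ≠ v)
      (f₁ f₂ : S.faces) (hne : f₁ ≠ f₂) (hu₁ : u ∈ f₁.1) (hv₁ : v ∈ f₁.1) (hu₂ : u ∈ f₂.1)
      (hv₂ : v ∈ f₂.1),
      S.faceMatrix.transpose.mulVecLin g
        ⟨{u, v}, (S.mem_edges_pair huv).2 ⟨f₁.1, f₁.2, hu₁, hv₁⟩⟩ = g f₁ + g f₂ := by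
    intro g u v huv f₁ f₂ hne hu₁ hv₁ hu₂ hv₂
    obtain ⟨F, G, hFG, hS⟩ := S.exists_face_pair huv ⟨f₁.1, f₁.2, hu₁, hv₁⟩
    have h1 := (hS f₁.1).1 ⟨f₁.2, hu₁, hv₁⟩
    have h2 := (hS f₂.1).1 ⟨f₂.2, hu₂, hv₂⟩
    have hne' : f₁.1 ≠ f₂.1 := fun h => hne (Subtype.ext h)
    have : ∀ t : S.faces, (u ∈ t.1 ∧ v ∈ t.1) ↔ t ∈ ({f₁, f₂} : Finset S.faces) := by
      intro t
      have := hS t.1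
      simp only [t.2, true_and] at this
      rw [this, Finset.mem_insert, Finset.mem_singleton, Subtype.ext_iff, Subtype.ext_iff]
      grind
    simp only [Matrix.mulVecLin_apply, Matrix.mulVec, dotProduct, Matrix.transpose_apply,
      faceMatrix, Matrix.of_apply, incidence, Finset.insert_subset_iff,
      Finset.singleton_subset_iff, this, ite_mul, one_mul, zero_mul]
    rw [Finset.sum_ite_mem, Finset.univ_inter, Finset.sum_pair hne]
  refine finrank_le_one ⟨fun _ => 1, ?_⟩ ?_
  · rw [LinearMap.mem_ker]
    ext ⟨e, he⟩
    have he' := he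
    simp only [edges, Finset.mem_filter, Finset.mem_univ, true_and] at he'
    obtain ⟨u, v, huv, rfl⟩ := Finset.card_eq_two.1 he'.1
    have hex := (S.mem_edges_pair huv).1 he
    obtain ⟨F, G, hFG, hS⟩ := S.exists_face_pair huv hex
    obtain ⟨hF, hF'⟩ := (hS F).2 (Or.inl rfl)
    obtain ⟨hG, hG'⟩ := (hS G).2 (Or.inr rfl)
    rw [hsum (fun _ => 1) u v huv ⟨F, hF⟩ ⟨G, hG⟩ (by simpa using hFG) hF'.1 hF'.2 hG'.1 hG'.2]
    rfl
  · rintro ⟨g, hg⟩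
    rw [LinearMap.mem_ker] at hg
    have hstar : ∀ (x : Fin n) (f₁ f₂ : S.faces), x ∈ f₁.1 → x ∈ f₂.1 → g f₁ = g f₂ := by
      intro x f₁ f₂ h₁ h₂
      refine S.star_induction x (R := fun f f' => ∀ (hf : f ∈ S.faces) (hf' : f' ∈ S.faces),
        g ⟨f, hf⟩ = g ⟨f', hf'⟩) ?_ ?_ f₁.2 f₂.2 h₁ h₂ f₁.2 f₂.2
      · intro f _ f' _ y hy hxf hyf hxf' hyf' hf hf'
        by_cases hff : f = f'
        · subst hff; rfl
        · have := hsum g x y hy.symm ⟨f, hf⟩ ⟨f', hf'⟩ (by simpa using hff) hxf hyf hxf' hyf'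
          rw [hg] at this
          exact zmod_two_eq_of_add_eq_zero this.symm
      · intro a b hb c hab hbc ha hc
        exact (hab ha hb).trans (hbc hb hc)
    have hconst : ∀ f₁ f₂ : S.faces, g f₁ = g f₂ := by
      intro f₁ f₂
      obtain ⟨u, hu⟩ := Finset.card_pos.1 (by rw [S.card_eq _ f₁.2]; norm_num : 0 < f₁.1.card)
      obtain ⟨v, hv⟩ := Finset.card_pos.1 (by rw [S.card_eq _ f₂.2]; norm_num : 0 < f₂.1.card)
      have hpath := S.conn u v
      induction hpath generalizing f₂ with
      | refl => exact hstar u f₁ f₂ hu hv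
      | @tail b c _ hbc ih =>
        obtain ⟨t, ht, hb, hc⟩ := hbc
        exact (ih ⟨t, ht⟩ hb).trans (hstar c ⟨t, ht⟩ f₂ hc hv)
    rcases isEmpty_or_nonempty S.faces with hn | ⟨⟨f⟩⟩
    · exact ⟨0, Subtype.ext (funext fun x => hn.elim x)⟩
    · exact ⟨g f, Subtype.ext (funext fun x => by simp [hconst x f])⟩

/-- If triangles `A i` of edges and edge cocycles `φ j` pair to the identity matrix, then their
number is at most the first Betti number over `ZMod 2`. -/
lemma card_le_two_sub_eulerChar {ι : Type*} [Fintype ι] (A : ι → Finset (Fin n))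
    (φ : ι → Finset (Fin n) → ZMod 2) (hcard : ∀ i, (A i).card = 3)
    (hA : ∀ i, (A i).powersetCard 2 ⊆ S.edges)
    (hφ : ∀ i, ∀ f ∈ S.faces, coboundary (φ i) f = 0)
    (hpair : ∀ i j, coboundary (φ j) (A i) = if i = j then 1 else 0) :
    (Fintype.card ι : ℤ) ≤ 2 - S.eulerChar := by
  set K := LinearMap.ker S.faceMatrix.mulVecLin with hK
  let ev : K →ₗ[ZMod 2] (ι → ZMod 2) :=
    (Matrix.of fun i e => S.incidence (A i) e).mulVecLin ∘ₗ K.subtype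
  have hev : LinearMap.range ev = ⊤ := by
    rw [eq_top_iff]
    intro c _
    have hmem : ∀ j, (fun e : S.edges => φ j e.1) ∈ K := by
      intro j
      rw [hK, LinearMap.mem_ker]
      ext f
      exact (S.sum_incidence (S.powersetCard_two_subset_edges f.2) (φ j)).trans (hφ j f.1 f.2)
    refine ⟨∑ j, c j • ⟨_, hmem j⟩, ?_⟩
    rw [map_sum]
    ext i
    simp only [map_smul, Finset.sum_apply, Pi.smul_apply, smul_eq_mul]
    have : ∀ j, ev ⟨_, hmem j⟩ i = if i = j then 1 else 0 := fun j =>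
      (S.sum_incidence (hA i) (φ j)).trans (hpair i j)
    simp [this]
  have hcob : ∀ (t : Finset (Fin n)), t.card = 3 → t.powersetCard 2 ⊆ S.edges →
      ∀ g : Fin n → ZMod 2, ∑ e : S.edges, S.incidence t e * S.vertexCoboundary g e = 0 := by
    intro t ht hsub g
    refine (S.sum_incidence hsub (fun e => ∑ x ∈ e, g x)).trans ?_
    obtain ⟨x, y, z, hxy, hxz, hyz, rfl⟩ := Finset.card_eq_three.1 ht
    rw [coboundary_triple _ hxy hxz hyz, Finset.sum_pair hxy, Finset.sum_pair hxz,
      Finset.sum_pair hyz]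
    generalize g x = a; generalize g y = b; generalize g z = c
    revert a b c; decide
  have hker : LinearMap.range S.vertexCoboundary ≤ (LinearMap.ker ev).map K.subtype := by
    rintro _ ⟨g, rfl⟩
    have hgK : S.vertexCoboundary g ∈ K := by
      rw [hK, LinearMap.mem_ker]
      ext f
      exact hcob f.1 (S.card_eq _ f.2) (S.powersetCard_two_subset_edges f.2) g
    refine ⟨⟨_, hgK⟩, ?_, rfl⟩
    change _ = _
    ext i
    exact hcob (A i) (hcard i) (hA i) g
  have h1 := Submodule.finrank_mono hker
  rw [Submodule.finrank_map_subtype_eq] at h1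
  have h2 := LinearMap.finrank_range_add_finrank_ker ev
  rw [hev, finrank_top, Module.finrank_fintype_fun_eq_card] at h2
  have h3 := LinearMap.finrank_range_add_finrank_ker S.faceMatrix.mulVecLin
  rw [Module.finrank_fintype_fun_eq_card, Fintype.card_coe, ← hK] at h3
  have h4 := S.faces_card_le_rank_add_one
  rw [Matrix.rank] at h4
  have h5 := S.le_finrank_range_vertexCoboundary
  rw [eulerChar]
  omega


lemma eq_or_eq_of_mem {u v : Fin n} (huv : u ≠ v) {f g t : Finset (Fin n)} (hf : f ∈ S.faces)
    (hg : g ∈ S.faces) (ht : t ∈ S.faces) (hfg : f ≠ g) (huf : u ∈ f) (hvf : v ∈ f)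
    (hug : u ∈ g) (hvg : v ∈ g) (hut : u ∈ t) (hvt : v ∈ t) : t = f ∨ t = g := by
  obtain ⟨F, G, -, hS⟩ := S.exists_face_pair huv ⟨f, hf, huf, hvf⟩
  have h1 := (hS f).1 ⟨hf, huf, hvf⟩
  have h2 := (hS g).1 ⟨hg, hug, hvg⟩
  have h3 := (hS t).1 ⟨ht, hut, hvt⟩
  grind

/-- `q` is the indicator of the edges crossed by a path of faces from `f` to `g` around `x`. -/
def IsDualArc (x : Fin n) (f g : Finset (Fin n)) (q : Finset (Fin n) → ZMod 2) : Prop :=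
  (∀ e, q e ≠ 0 → x ∈ e) ∧
    ∀ h ∈ S.faces, coboundary q h = (if h = f then 1 else 0) + (if h = g then 1 else 0)

variable {S}

lemma IsDualArc.symm {x : Fin n} {f g : Finset (Fin n)} {q : Finset (Fin n) → ZMod 2}
    (h : S.IsDualArc x f g q) : S.IsDualArc x g f q :=
  ⟨h.1, fun t ht => by rw [h.2 t ht, add_comm]⟩

lemma IsDualArc.trans {x : Fin n} {f g h : Finset (Fin n)} {p q : Finset (Fin n) → ZMod 2}
    (hp : S.IsDualArc x f g p) (hq : S.IsDualArc x g h q) : S.IsDualArc x f h (p + q) := by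
  refine ⟨fun e he => ?_, fun t ht => ?_⟩
  · by_cases hpe : p e = 0
    · exact hq.1 e (by simpa [hpe] using he)
    · exact hp.1 e hpe
  · rw [coboundary_add, hp.2 t ht, hq.2 t ht]
    generalize (if t = f then 1 else 0 : ZMod 2) = a
    generalize (if t = g then 1 else 0 : ZMod 2) = b
    generalize (if t = h then 1 else 0 : ZMod 2) = c
    revert a b c; decide

variable (S)

lemma exists_isDualArc {x : Fin n} {f g : Finset (Fin n)} (hf : f ∈ S.faces) (hg : g ∈ S.faces)
    (hxf : x ∈ f) (hxg : x ∈ g) : ∃ q, S.IsDualArc x f g q := by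
  refine S.star_induction x (R := fun f g => ∃ q, S.IsDualArc x f g q) ?_ ?_ hf hg hxf hxg
  · intro f hf g hg y hy hxf hyf hxg hyg
    by_cases hfg : f = g
    · subst hfg
      refine ⟨0, by simp, fun h _ => ?_⟩
      rw [CharTwo.add_self_eq_zero]
      simp [coboundary]
    · refine ⟨fun e => if e = {x, y} then 1 else 0, ?_, fun h hh => ?_⟩
      · intro e he
        have : e = {x, y} := by by_contra hne; simp [hne] at he
        simp [this]
      · rw [coboundary, Finset.sum_ite_eq']
        have hiff : ({x, y} : Finset (Fin n)) ∈ h.powersetCard 2 ↔ h = f ∨ h = g := by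
          rw [Finset.mem_powersetCard, Finset.card_pair hy.symm, Finset.insert_subset_iff,
            Finset.singleton_subset_iff]
          constructor
          · rintro ⟨⟨h1, h2⟩, -⟩
            exact S.eq_or_eq_of_mem hy.symm hf hg hh hfg hxf hyf hxg hyg h1 h2
          · rintro (rfl | rfl)
            · exact ⟨⟨hxf, hyf⟩, rfl⟩
            · exact ⟨⟨hxg, hyg⟩, rfl⟩
        simp only [hiff]
        by_cases h1 : h = f
        · have h2 : h ≠ g := fun h2 => hfg (h1.symm.trans h2)
          simp [h1, hfg]
        · by_cases h2 : h = g <;> simp [h1, h2]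
          intro h3; exact absurd h3.symm hfg
  · rintro f g - h ⟨p, hp⟩ ⟨q, hq⟩
    exact ⟨p + q, hp.trans hq⟩

/-- The link of a vertex, as a graph on all vertices. -/
def linkGraph (v : Fin n) : SimpleGraph (Fin n) where
  Adj x y := x ≠ y ∧ x ≠ v ∧ y ≠ v ∧ ({v, x, y} : Finset (Fin n)) ∈ S.faces
  symm := ⟨fun x y ⟨h1, h2, h3, h4⟩ => ⟨h1.symm, h3, h2, by rwa [Finset.pair_comm]⟩⟩
  loopless := ⟨fun _ h => h.1 rfl⟩

lemma exists_eq_triple {f : Finset (Fin n)} (hf : f ∈ S.faces) {u v : Fin n} (huv : u ≠ v)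
    (hu : u ∈ f) (hv : v ∈ f) : ∃ w, w ≠ u ∧ w ≠ v ∧ f = {u, v, w} := by
  obtain ⟨x, y, z, hxy, hxz, hyz, rfl⟩ := Finset.card_eq_three.1 (S.card_eq f hf)
  simp only [Finset.mem_insert, Finset.mem_singleton] at hu hv
  have key : ∃ w, w ≠ u ∧ w ≠ v ∧ ∀ t, (t = x ∨ t = y ∨ t = z) ↔ (t = u ∨ t = v ∨ t = w) := by
    rcases hu with rfl | rfl | rfl <;> rcases hv with rfl | rfl | rfl
    · exact absurd rfl huv
    · exact ⟨z, by grind⟩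
    · exact ⟨y, by grind⟩
    · exact ⟨z, by grind⟩
    · exact absurd rfl huv
    · exact ⟨x, by grind⟩
    · exact ⟨y, by grind⟩
    · exact ⟨x, by grind⟩
    · exact absurd rfl huv
  obtain ⟨w, h1, h2, h3⟩ := key
  exact ⟨w, h1, h2, by ext t; simpa using h3 t⟩

lemma triple_ne {u v w : Fin n} (h : ({u, v, w} : Finset (Fin n)) ∈ S.faces) :
    u ≠ v ∧ u ≠ w ∧ v ≠ w := by
  have h3 := S.card_eq _ h
  refine ⟨?_, ?_, ?_⟩ <;>
  · rintro rfl
    simp only [Finset.mem_insert, Finset.mem_singleton, or_true, true_or, Finset.insert_eq_of_mem] at h3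
    exact absurd h3 (Finset.card_le_two.trans_lt (by norm_num)).ne

lemma triple_eq_iff {u v x y : Fin n} (hxu : x ≠ u) (hxv : x ≠ v) :
    ({u, v, x} : Finset (Fin n)) = {u, v, y} ↔ x = y := by
  constructor
  · intro h
    have := Finset.ext_iff.1 h x
    simp only [Finset.mem_insert, Finset.mem_singleton] at this
    grind
  · rintro rfl; rfl

lemma linkGraph_isCycles (v : Fin n) : (S.linkGraph v).IsCycles := by
  rintro x ⟨y, hxy, hxv, hyv, hf⟩
  obtain ⟨F, G, hFG, hS⟩ := S.exists_face_pair hxv.symm ⟨_, hf, by simp, by simp⟩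
  obtain ⟨hF, hvF, hxF⟩ := (hS F).2 (Or.inl rfl)
  obtain ⟨hG, hvG, hxG⟩ := (hS G).2 (Or.inr rfl)
  obtain ⟨a, hav, hax, rfl⟩ := S.exists_eq_triple hF hxv.symm hvF hxF
  obtain ⟨b, hbv, hbx, rfl⟩ := S.exists_eq_triple hG hxv.symm hvG hxG
  have hab : a ≠ b := by rintro rfl; exact hFG rfl
  rw [Set.ncard_eq_two]
  refine ⟨a, b, hab, ?_⟩
  ext z
  simp only [SimpleGraph.mem_neighborSet, Set.mem_insert_iff, Set.mem_singleton_iff]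
  constructor
  · rintro ⟨hxz, -, hzv, hz⟩
    have := (hS _).1 ⟨hz, by simp, by simp⟩
    rwa [triple_eq_iff hzv hxz.symm, triple_eq_iff hzv hxz.symm] at this
  · rintro (rfl | rfl)
    · exact ⟨hax.symm, hxv, hav, hF⟩
    · exact ⟨hbx.symm, hxv, hbv, hG⟩

/-- A cyclic enumeration `w 0 = w m, w 1, …, w m` of the link of `v`. -/
structure IsLinkCycle (v : Fin n) (m : ℕ) (w : ℕ → Fin n) : Prop where
  three_le : 3 ≤ m
  adj : ∀ i < m, (S.linkGraph v).Adj (w i) (w (i + 1))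
  closed : w 0 = w m
  inj : ∀ i j, 1 ≤ i → i ≤ m → 1 ≤ j → j ≤ m → w i = w j → i = j
  surj : ∀ x, x ≠ v → (∃ f ∈ S.faces, v ∈ f ∧ x ∈ f) → ∃ i, 1 ≤ i ∧ i ≤ m ∧ w i = x

lemma exists_isLinkCycle (v : Fin n) : ∃ m w, S.IsLinkCycle v m w := by
  obtain ⟨f, hf, hvf⟩ := S.vertex_mem v
  obtain ⟨x, hxf, hxv⟩ := S.exists_mem_ne hf v
  obtain ⟨y, hyv, hyx, rfl⟩ := S.exists_eq_triple hf hxv.symm hvf hxf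
  obtain ⟨p, hp, hverts⟩ :=
    (S.linkGraph_isCycles v).exists_cycle_toSubgraph_verts_eq_connectedComponentSupp
      (c := (S.linkGraph v).connectedComponentMk x) (v := x) rfl ⟨y, hyx.symm, hxv, hyv, hf⟩
  refine ⟨p.length, p.getVert, hp.three_le_length, fun i hi => p.adj_getVert_succ hi, by simp,
    fun i j hi hi' hj hj' h => hp.getVert_injOn ⟨hi, hi'⟩ ⟨hj, hj'⟩ h, ?_⟩
  rintro z hzv ⟨g, hg, hvg, hzg⟩
  have hpath := S.link_cycle v x z ⟨_, hf, hvf, hxf, hxv⟩ ⟨g, hg, hvg, hzg, hzv⟩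
  have hreach : (S.linkGraph v).Reachable z x := by
    clear hzg hzv
    induction hpath with
    | refl => exact SimpleGraph.Reachable.refl _
    | tail _ h ih => exact (SimpleGraph.Adj.reachable (G := S.linkGraph v) h).symm.trans ih
  have hz : z ∈ p.support := by
    rw [← SimpleGraph.Walk.mem_verts_toSubgraph, hverts]
    exact SimpleGraph.ConnectedComponent.sound hreach
  obtain ⟨i, hi, hil⟩ := SimpleGraph.Walk.mem_support_iff_exists_getVert.1 hz
  rcases Nat.eq_zero_or_pos i with rfl | hpos
  · have := hp.three_le_length
    exact ⟨p.length, by omega, le_rfl, by simpa using hi⟩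
  · exact ⟨i, hpos, hil, hi⟩

variable {S}

namespace IsLinkCycle

variable {v : Fin n} {m : ℕ} {w : ℕ → Fin n}

lemma ne (h : S.IsLinkCycle v m w) {i : ℕ} (hi : i ≤ m) : w i ≠ v := by
  rcases Nat.eq_zero_or_pos i with rfl | hpos
  · exact (h.adj 0 (by have := h.three_le; omega)).2.1
  · obtain ⟨k, rfl⟩ := Nat.exists_eq_succ_of_ne_zero hpos.ne'
    exact (h.adj k (by omega)).2.2.1

lemma inj' (h : S.IsLinkCycle v m w) {i j : ℕ} (hi : i ≤ m) (hj : j ≤ m) (hij : w i = w j) :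
    i = j ∨ (i = 0 ∧ j = m) ∨ (i = m ∧ j = 0) := by
  have h1 := h.inj
  have h2 := h.closed
  have h3 := h.three_le
  grind

lemma face_inj (h : S.IsLinkCycle v m w) {i j : ℕ} (hi : i < m) (hj : j < m) :
    ({v, w i, w (i + 1)} : Finset (Fin n)) = {v, w j, w (j + 1)} ↔ i = j := by
  refine ⟨fun heq => ?_, by rintro rfl; rfl⟩
  have h1 := Finset.ext_iff.1 heq (w i)
  have h2 := Finset.ext_iff.1 heq (w (i + 1))
  simp only [Finset.mem_insert, Finset.mem_singleton, true_or, or_true, true_iff,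
    h.ne hi.le, h.ne (Nat.succ_le_of_lt hi), false_or] at h1 h2
  have h3 := h.three_le
  have hne := (h.adj i hi).1
  rcases h1 with h1 | h1
  · have := h.inj' hi.le hj.le h1
    omega
  · rcases h2 with h2 | h2
    · have a1 := h.inj' hi.le (Nat.succ_le_of_lt hj) h1
      have a2 := h.inj' (Nat.succ_le_of_lt hi) hj.le h2
      omega
    · exact absurd (h1.trans h2.symm) hne

lemma exists_face_eq (h : S.IsLinkCycle v m w) {f : Finset (Fin n)} (hf : f ∈ S.faces)
    (hvf : v ∈ f) : ∃ i < m, f = {v, w i, w (i + 1)} := by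
  obtain ⟨x, hxf, hxv⟩ := S.exists_mem_ne hf v
  obtain ⟨i, hi, him, rfl⟩ := h.surj x hxv ⟨f, hf, hvf, hxf⟩
  have h3 := h.three_le
  obtain ⟨k, rfl⟩ := Nat.exists_eq_succ_of_ne_zero (by omega : i ≠ 0)
  have hk : k < m := by omega
  obtain ⟨l, hl, hlk, hwl⟩ : ∃ l, l < m ∧ l ≠ k ∧ w l = w (k + 1) := by
    rcases Nat.lt_or_ge (k + 1) m with hlt | hge
    · exact ⟨k + 1, hlt, by omega, rfl⟩
    · exact ⟨0, by omega, by omega, by rw [h.closed]; congr 1; omega⟩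
  have := S.eq_or_eq_of_mem hxv.symm (h.adj k hk).2.2.2 (h.adj l hl).2.2.2 hf
    (by rw [Ne, h.face_inj hk hl]; exact hlk.symm) (by simp) (by simp) (by simp) (by simp [hwl])
    hvf hxf
  rcases this with h1 | h1
  · exact ⟨k, hk, h1⟩
  · exact ⟨l, hl, h1⟩

lemma exists_isDualArc_interval (h : S.IsLinkCycle v m w) {r t : ℕ} (hr : 1 ≤ r) (hrt : r < t)
    (ht : t < m) : ∃ p, S.IsDualArc v {v, w r, w (r + 1)} {v, w t, w (t + 1)} p ∧
      ∀ k ≤ m, p {v, w k} = if r < k ∧ k ≤ t then 1 else 0 := by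
  set p : Finset (Fin n) → ZMod 2 := fun e => if ∃ k, r < k ∧ k ≤ t ∧ e = {v, w k} then 1 else 0
  have hval : ∀ k ≤ m, p {v, w k} = if r < k ∧ k ≤ t then 1 else 0 := by
    intro k hk
    refine if_congr ⟨?_, fun hk' => ⟨k, hk'.1, hk'.2, rfl⟩⟩ rfl rfl
    rintro ⟨k', h1, h2, heq⟩
    have h3 := Finset.ext_iff.1 heq (w k)
    simp only [Finset.mem_insert, Finset.mem_singleton, or_true, true_iff, h.ne hk,
      false_or] at h3
    have := h.inj' hk (by omega) h3
    omega
  have hsupp : ∀ e, p e ≠ 0 → v ∈ e := by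
    intro e he
    by_contra hv
    refine he (if_neg ?_)
    rintro ⟨k, -, -, rfl⟩
    simp at hv
  refine ⟨p, ⟨hsupp, fun f hf => ?_⟩, hval⟩
  by_cases hvf : v ∈ f
  · obtain ⟨i, hi, rfl⟩ := h.exists_face_eq hf hvf
    have hadj := h.adj i hi
    rw [coboundary_triple _ hadj.2.1.symm hadj.2.2.1.symm hadj.1, hval i hi.le, hval (i + 1) hi]
    have h0 : p {w i, w (i + 1)} = 0 := by
      by_contra hne
      have := hsupp _ hne
      simp only [Finset.mem_insert, Finset.mem_singleton] at this
      rcases this with h1 | h1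
      · exact hadj.2.1 h1.symm
      · exact hadj.2.2.1 h1.symm
    simp only [h0, h.face_inj hi (hrt.trans ht), h.face_inj hi ht, add_zero]
    by_cases h1 : i = r
    · subst h1
      rw [if_neg (by omega), if_pos (by omega), if_pos rfl, if_neg (by omega), add_comm]
    · by_cases h2 : i = t
      · subst h2
        rw [if_pos (by omega), if_neg (by omega), if_neg h1, if_pos rfl, add_comm]
      · rw [if_neg h1, if_neg h2]
        by_cases h3 : r < i ∧ i ≤ t
        · rw [if_pos h3, if_pos (by omega)]; rfl
        · rw [if_neg h3, if_neg (by omega)]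
  · rw [if_neg (by rintro rfl; simp at hvf), if_neg (by rintro rfl; simp at hvf), add_zero]
    refine Finset.sum_eq_zero fun e he => ?_
    by_contra hne
    exact hvf ((Finset.mem_powersetCard.1 he).1 (hsupp e hne))

end IsLinkCycle

variable (S)

lemma subset_of_tetrahedron {x a b c : Fin n} (hxa : x ≠ a) (hxb : x ≠ b) (hxc : x ≠ c)
    (hab : a ≠ b) (hac : a ≠ c) (hbc : b ≠ c) (h₁ : ({x, a, b} : Finset (Fin n)) ∈ S.faces)
    (h₂ : ({x, a, c} : Finset (Fin n)) ∈ S.faces) (h₃ : ({x, b, c} : Finset (Fin n)) ∈ S.faces)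
    {f : Finset (Fin n)} (hf : f ∈ S.faces) (hxf : x ∈ f) : f ⊆ {x, a, b, c} := by
  have h12 : ({x, a, b} : Finset (Fin n)) ≠ {x, a, c} := by
    rw [Ne, triple_eq_iff hxb.symm hab.symm]; exact hbc
  have h13 : ({x, a, b} : Finset (Fin n)) ≠ {x, b, c} := by
    rw [Finset.pair_comm a b, Ne, triple_eq_iff hxa.symm hab]; exact hac
  have h23 : ({x, a, c} : Finset (Fin n)) ≠ {x, b, c} := by
    rw [Finset.pair_comm a c, Finset.pair_comm b c, Ne, triple_eq_iff hxa.symm hac]; exact hab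
  refine S.star_induction x (R := fun f g => f ⊆ {x, a, b, c} → g ⊆ {x, a, b, c}) ?_ ?_ h₁ hf
    (by simp) hxf (by grind)
  · intro f _ g hg y hyx hxf hyf hxg hyg hsub
    have hy := hsub hyf
    simp only [Finset.mem_insert, Finset.mem_singleton, hyx, false_or] at hy
    rcases hy with rfl | rfl | rfl
    · rcases S.eq_or_eq_of_mem hxa h₁ h₂ hg h12 (by simp) (by simp) (by simp) (by simp) hxg hyg
        with rfl | rfl <;> grind
    · rcases S.eq_or_eq_of_mem hxb h₁ h₃ hg h13 (by simp) (by simp) (by simp) (by simp) hxg hyg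
        with rfl | rfl <;> grind
    · rcases S.eq_or_eq_of_mem hxc h₂ h₃ hg h23 (by simp) (by simp) (by simp) (by simp) hxg hyg
        with rfl | rfl <;> grind
  · exact fun f g _ h hfg hgh hf => hgh (hfg hf)

lemma le_four_of_tetrahedron {x a b c : Fin n} (hxa : x ≠ a) (hxb : x ≠ b) (hxc : x ≠ c)
    (hab : a ≠ b) (hac : a ≠ c) (hbc : b ≠ c) (h₁ : ({x, a, b} : Finset (Fin n)) ∈ S.faces)
    (h₂ : ({x, a, c} : Finset (Fin n)) ∈ S.faces) (h₃ : ({x, b, c} : Finset (Fin n)) ∈ S.faces)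
    (h₄ : ({a, b, c} : Finset (Fin n)) ∈ S.faces) : n ≤ 4 := by
  have perm : ∀ {p q r p' q' r' : Fin n}, ({p, q, r} : Finset (Fin n)) ∈ S.faces →
      ({p', q', r'} : Finset (Fin n)) = {p, q, r} → ({p', q', r'} : Finset (Fin n)) ∈ S.faces :=
    fun h e => e ▸ h
  have hK : ∀ y, y ∈ ({x, a, b, c} : Finset (Fin n)) → ∀ f ∈ S.faces, y ∈ f →
      f ⊆ ({x, a, b, c} : Finset (Fin n)) := by
    intro y hy f hf hyf
    simp only [Finset.mem_insert, Finset.mem_singleton] at hy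
    rcases hy with rfl | rfl | rfl | rfl
    · exact S.subset_of_tetrahedron hxa hxb hxc hab hac hbc h₁ h₂ h₃ hf hyf
    · exact (S.subset_of_tetrahedron hxa.symm hab hac hxb hxc hbc (perm h₁ (by grind))
        (perm h₂ (by grind)) h₄ hf hyf).trans (by grind)
    · exact (S.subset_of_tetrahedron hxb.symm hab.symm hbc hxa hxc hac (perm h₁ (by grind))
        (perm h₃ (by grind)) (perm h₄ (by grind)) hf hyf).trans (by grind)
    · exact (S.subset_of_tetrahedron hxc.symm hac.symm hbc.symm hxa hxb hab (perm h₂ (by grind))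
        (perm h₃ (by grind)) (perm h₄ (by grind)) hf hyf).trans (by grind)
  have hall : ∀ y, y ∈ ({x, a, b, c} : Finset (Fin n)) := by
    intro y
    induction S.conn x y with
    | refl => simp
    | tail _ h ih =>
      obtain ⟨f, hf, h1, h2⟩ := h
      exact hK _ ih f hf h1 h2
  calc n = (Finset.univ : Finset (Fin n)).card := by simp
    _ ≤ ({x, a, b, c} : Finset (Fin n)).card := Finset.card_le_card fun y _ => hall y
    _ ≤ 4 := Finset.card_le_four

lemma Irreducible.exists_nonfacial (hS : S.Irreducible) (hn : 4 < n) {u v : Fin n} (huv : u ≠ v)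
    (h : ∃ f ∈ S.faces, u ∈ f ∧ v ∈ f) :
    ∃ w, w ≠ u ∧ w ≠ v ∧ ({u, w} : Finset (Fin n)) ∈ S.edges ∧
      ({v, w} : Finset (Fin n)) ∈ S.edges ∧ ({u, v, w} : Finset (Fin n)) ∉ S.faces := by
  by_contra hcon
  push Not at hcon
  refine hS ⟨u, v, (S.mem_edges_pair huv).2 h, hcon, ?_⟩
  rintro ⟨w, z, h1, h2, hwz, h3, h4⟩
  have aux := fun {p q r : Fin n} (hf : ({p, q, r} : Finset (Fin n)) ∈ S.faces) =>
    S.triple_ne hf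
  have := S.le_four_of_tetrahedron huv (aux h1).2.1 (aux h2).2.1 (aux h1).2.2 (aux h2).2.2 hwz
    h1 h2 h3 h4
  omega

/-- The triangles of edges `{v, a, c}` and `{v, b, d}` cross at `v`: the cocycle `φ`, supported
near the second one, evaluates to `1` on the first one. -/
structure IsCrossing (v a c b d : Fin n) (φ : Finset (Fin n) → ZMod 2) : Prop where
  nodup : [v, a, c, b, d].Nodup
  edges_subset : ({v, a, c} : Finset (Fin n)).powersetCard 2 ⊆ S.edges
  cocycle : ∀ f ∈ S.faces, coboundary φ f = 0
  support : ∀ e, φ e ≠ 0 → v ∈ e ∨ b ∈ e ∨ d ∈ e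
  pairing : coboundary φ {v, a, c} = 1

lemma exists_isCrossing_of_isDualArc {v a c b d : Fin n} (hnodup : [v, a, c, b, d].Nodup)
    (hva : ({v, a} : Finset (Fin n)) ∈ S.edges) (hvc : ({v, c} : Finset (Fin n)) ∈ S.edges)
    (hac : ({a, c} : Finset (Fin n)) ∈ S.edges) (hbd : ({b, d} : Finset (Fin n)) ∈ S.edges)
    {f g : Finset (Fin n)} (hf : f ∈ S.faces) (hg : g ∈ S.faces) (hbf : b ∈ f) (hdg : d ∈ g)
    {p : Finset (Fin n) → ZMod 2} (hp : S.IsDualArc v f g p) (hpac : p {v, a} + p {v, c} = 1) :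
    ∃ φ, S.IsCrossing v a c b d φ := by
  have hne := hnodup
  simp only [List.nodup_cons, List.mem_cons, List.not_mem_nil, or_false, not_or] at hne
  obtain ⟨⟨hva', hvc', hvb', hvd'⟩, ⟨hac', hab', had'⟩, ⟨hcb', hcd'⟩, hbd', -⟩ := hne
  obtain ⟨h, hh, hbh, hdh⟩ := (S.mem_edges_pair hbd').1 hbd
  obtain ⟨q, hq⟩ := S.exists_isDualArc hf hh hbf hbh
  obtain ⟨r, hr⟩ := S.exists_isDualArc hh hg hdh hdg
  have hzero : ∀ {x : Fin n} {s : Finset (Fin n) → ZMod 2}, (∀ e, s e ≠ 0 → x ∈ e) →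
      ∀ e, x ∉ e → s e = 0 := fun hs e hxe => by_contra fun hne => hxe (hs e hne)
  refine ⟨p + (q + r), hnodup, ?_, fun t ht => ?_, fun e he => ?_, ?_⟩
  · rw [powersetCard_two_triple hva' hvc' hac']
    grind
  · rw [coboundary_add, coboundary_add, hp.2 t ht, hq.2 t ht, hr.2 t ht]
    generalize (if t = f then 1 else 0 : ZMod 2) = x
    generalize (if t = g then 1 else 0 : ZMod 2) = y
    generalize (if t = h then 1 else 0 : ZMod 2) = z
    revert x y z; decide
  · by_contra hcon
    push Not at hcon
    apply he
    simp [hzero hp.1 e hcon.1, hzero hq.1 e hcon.2.1, hzero hr.1 e hcon.2.2]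
  · rw [coboundary_triple _ hva' hvc' hac']
    simp only [Pi.add_apply]
    rw [hzero hp.1 {a, c} (by grind), hzero hq.1 {a, c} (by grind), hzero hr.1 {a, c} (by grind),
      hzero hq.1 {v, a} (by grind), hzero hr.1 {v, a} (by grind), hzero hq.1 {v, c} (by grind),
      hzero hr.1 {v, c} (by grind)]
    simpa using hpac

variable {S}

lemma Irreducible.exists_isCrossing (hS : S.Irreducible) (hn : 4 < n) (v : Fin n) :
    ∃ a c b d φ, S.IsCrossing v a c b d φ := by
  obtain ⟨m, w, hw⟩ := S.exists_isLinkCycle v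
  have h3 := hw.three_le
  have hspoke : ∀ i, 1 ≤ i → i ≤ m → ({v, w i} : Finset (Fin n)) ∈ S.edges := by
    intro i hi him
    obtain ⟨k, rfl⟩ := Nat.exists_eq_succ_of_ne_zero (by omega : i ≠ 0)
    exact (S.mem_edges_pair (hw.ne him).symm).2 ⟨_, (hw.adj k him).2.2.2, by simp, by simp⟩
  have hchord : ∀ i, 1 ≤ i → i ≤ m → ∃ j, 1 ≤ j ∧ j ≤ m ∧ j ≠ i ∧
      ({w i, w j} : Finset (Fin n)) ∈ S.edges ∧ ({v, w i, w j} : Finset (Fin n)) ∉ S.faces := by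
    intro i hi him
    have hne := (hw.ne him).symm
    obtain ⟨x, hxv, hxw, h1, h2, h4⟩ :=
      hS.exists_nonfacial S hn hne ((S.mem_edges_pair hne).1 (hspoke i hi him))
    obtain ⟨j, hj, hjm, rfl⟩ := hw.surj x hxv ((S.mem_edges_pair hxv.symm).1 h1)
    exact ⟨j, hj, hjm, by rintro rfl; exact hxw rfl, h2, h4⟩
  have hex : ∃ k, ∃ i, 1 ≤ i ∧ i + k ≤ m ∧ 0 < k ∧ ({w i, w (i + k)} : Finset (Fin n)) ∈ S.edges ∧
      ({v, w i, w (i + k)} : Finset (Fin n)) ∉ S.faces := by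
    obtain ⟨j, hj, hjm, hne, h1, h2⟩ := hchord 1 le_rfl (by omega)
    exact ⟨j - 1, 1, le_rfl, by omega, by omega, by rwa [Nat.add_sub_cancel' hj],
      by rwa [Nat.add_sub_cancel' hj]⟩
  obtain ⟨i, hi, him, hk, he, hf⟩ := Nat.find_spec hex
  have hmin := fun k => Nat.find_min hex (m := k)
  set k := Nat.find hex
  have hk1 : k ≠ 1 := by
    intro h1
    rw [h1] at hf him
    exact hf (hw.adj i (by omega)).2.2.2
  obtain ⟨l, hl, hlm, hlne, hle, hlf⟩ := hchord (i + 1) (by omega) (by omega)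
  have hout : l < i ∨ i + k < l := by
    by_contra hcon
    rcases Nat.lt_or_ge l (i + 1) with hlt | hge
    · refine hmin (i + 1 - l) (by omega) ⟨l, hl, by omega, by omega, ?_, ?_⟩
      · rwa [Nat.add_sub_cancel' hlt.le, Finset.pair_comm]
      · rwa [Nat.add_sub_cancel' hlt.le, Finset.pair_comm (w l)]
    · refine hmin (l - (i + 1)) (by omega) ⟨i + 1, by omega, by omega, by omega, ?_, ?_⟩
      · rwa [Nat.add_sub_cancel' hge]
      · rwa [Nat.add_sub_cancel' hge]
  have hwne : ∀ {x y}, 1 ≤ x → x ≤ m → 1 ≤ y → y ≤ m → x ≠ y → w x ≠ w y :=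
    fun h1 h2 h3 h4 hne h => hne (hw.inj _ _ h1 h2 h3 h4 h)
  have hnodup : [v, w i, w (i + k), w (i + 1), w l].Nodup := by
    simp only [List.nodup_cons, List.mem_cons, List.not_mem_nil, or_false, not_or,
      not_false_eq_true, List.nodup_nil, and_true]
    exact ⟨⟨(hw.ne (by omega)).symm, (hw.ne (by omega)).symm, (hw.ne (by omega)).symm,
      (hw.ne (by omega)).symm⟩, ⟨by apply hwne <;> omega, by apply hwne <;> omega,
      by apply hwne <;> omega⟩, ⟨by apply hwne <;> omega, by apply hwne <;> omega⟩,
      by apply hwne <;> omega⟩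
  refine ⟨w i, w (i + k), w (i + 1), w l, ?_⟩
  rcases hout with hlt | hgt
  · obtain ⟨p, hp, hval⟩ := hw.exists_isDualArc_interval hl hlt (by omega)
    refine S.exists_isCrossing_of_isDualArc hnodup (hspoke _ (by omega) (by omega))
      (hspoke _ (by omega) (by omega)) he hle (hw.adj i (by omega)).2.2.2
      (hw.adj l (by omega)).2.2.2 (by simp) (by simp) hp.symm ?_
    rw [hval _ (by omega), hval _ (by omega), if_pos (by omega), if_neg (by omega), add_zero]
  · obtain ⟨p, hp, hval⟩ := hw.exists_isDualArc_interval (r := i) (t := l - 1) hi (by omega)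
      (by omega)
    refine S.exists_isCrossing_of_isDualArc hnodup (hspoke _ (by omega) (by omega))
      (hspoke _ (by omega) (by omega)) he hle (hw.adj i (by omega)).2.2.2
      (hw.adj (l - 1) (by omega)).2.2.2 (by simp) (by simp [Nat.sub_add_cancel hl]) hp ?_
    rw [hval _ (by omega), hval _ (by omega), if_neg (by omega), if_pos (by omega), zero_add]

/-- Some three-colouring of a set of `n` points is good for at least `n / 3 ^ 5` of the points,
where each point prescribes the colours of five distinct points. -/
lemma exists_coloring (t : Fin n → Fin 5 → Fin n) (ht : ∀ v, Function.Injective (t v))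
    (κ : Fin 5 → Fin 3) :
    ∃ c : Fin n → Fin 3,
      n ≤ 3 ^ 5 * (Finset.univ.filter fun v => ∀ i, c (t v i) = κ i).card := by
  by_contra hcon
  push Not at hcon
  have hcount : ∀ v, 3 ^ n ≤ 3 ^ 5 *
      (Finset.univ.filter fun c : Fin n → Fin 3 => ∀ i, c (t v i) = κ i).card := by
    intro v
    have hfib := Finset.card_le_mul_card_image_of_maps_to
      (s := (Finset.univ : Finset (Fin n → Fin 3)))
      (t := Finset.univ.filter fun c : Fin n → Fin 3 => ∀ i, c (t v i) = κ i)
      (f := fun c => Function.extend (t v) κ c) (n := 3 ^ 5) ?_ ?_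
    · simpa using hfib
    · intro c _
      simp [(ht v).extend_apply]
    · intro c' _
      calc _ ≤ (Finset.univ : Finset (Fin 5 → Fin 3)).card := by
            refine Finset.card_le_card_of_injOn (fun c i => c (t v i)) (by simp) ?_
            intro c hc d hd hcd
            have hcd' : Function.extend (t v) κ c = Function.extend (t v) κ d := by
              simp only [Finset.coe_filter, Finset.mem_univ, true_and, Set.mem_ofPred_eq] at hc hd
              rw [hc, hd]
            funext x
            by_cases hx : ∃ i, t v i = x
            · obtain ⟨i, rfl⟩ := hx
              exact congrFun hcd i
            · have := congrFun hcd' x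
              rwa [Function.extend_apply' _ _ _ hx, Function.extend_apply' _ _ _ hx] at this
        _ = 3 ^ 5 := by simp
  have hdouble : ∑ v : Fin n,
      (Finset.univ.filter fun c : Fin n → Fin 3 => ∀ i, c (t v i) = κ i).card =
      ∑ c : Fin n → Fin 3, (Finset.univ.filter fun v => ∀ i, c (t v i) = κ i).card := by
    simp only [Finset.card_filter]
    exact Finset.sum_comm
  have h1 : n * 3 ^ n ≤ 3 ^ 5 * ∑ v : Fin n,
      (Finset.univ.filter fun c : Fin n → Fin 3 => ∀ i, c (t v i) = κ i).card := by
    rw [Finset.mul_sum]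
    simpa using Finset.sum_le_sum fun v (_ : v ∈ Finset.univ) => hcount v
  have h2 : 3 ^ 5 * ∑ c : Fin n → Fin 3,
      (Finset.univ.filter fun v => ∀ i, c (t v i) = κ i).card < n * 3 ^ n := by
    rw [Finset.mul_sum]
    have := Finset.sum_lt_sum_of_nonempty Finset.univ_nonempty
      fun c (_ : c ∈ Finset.univ) => hcon c
    simpa [mul_comm] using this
  rw [hdouble] at h1
  exact absurd h1 h2.not_ge

lemma Irreducible.le_of_four_lt (hS : S.Irreducible) (hn : 4 < n) :
    (n : ℤ) ≤ 3 ^ 5 * (2 - S.eulerChar) := by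
  choose a c b d φ h using hS.exists_isCrossing hn
  obtain ⟨col, hcol⟩ := exists_coloring (fun v => ![v, a v, c v, b v, d v])
    (fun v => by
      have := List.nodup_iff_injective_get.1 (h v).nodup
      intro i j hij
      apply this
      fin_cases i <;> fin_cases j <;> first | rfl | simpa using hij)
    ![0, 1, 1, 2, 2]
  set G := Finset.univ.filter fun v => ∀ i, col (![v, a v, c v, b v, d v] i) =
    (![0, 1, 1, 2, 2] : Fin 5 → Fin 3) i with hG
  have hgood : ∀ v : G, col v.1 = 0 ∧ col (a v.1) = 1 ∧ col (c v.1) = 1 ∧ col (b v.1) = 2 ∧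
      col (d v.1) = 2 := by
    rintro ⟨v, hv⟩
    have hv' := (Finset.mem_filter.1 hv).2
    exact ⟨hv' 0, hv' 1, hv' 2, hv' 3, hv' 4⟩
  have hne : ∀ v, v ≠ a v ∧ v ≠ c v ∧ a v ≠ c v := by
    intro v
    have := (h v).nodup
    simp only [List.nodup_cons, List.mem_cons, List.not_mem_nil, or_false, not_or] at this
    exact ⟨this.1.1, this.1.2.1, this.2.1.1⟩
  have hcard := S.card_le_two_sub_eulerChar (fun v : G => {v.1, a v.1, c v.1})
    (fun v : G => φ v.1)
    (fun v => Finset.card_eq_three.2 ⟨_, _, _, (hne v.1).1, (hne v.1).2.1, (hne v.1).2.2, rfl⟩)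
    (fun v => (h v.1).edges_subset) (fun v => (h v.1).cocycle) (fun u v => by
      split_ifs with huv
      · subst huv
        exact (h u.1).pairing
      · refine Finset.sum_eq_zero fun e he => ?_
        by_contra hφ
        have hsub := (Finset.mem_powersetCard.1 he).1
        have hu := hgood u
        have hv := hgood v
        have huv' : v.1 ≠ u.1 := fun h => huv (Subtype.ext h.symm)
        rcases (h v.1).support e hφ with hm | hm | hm <;>
        · have := hsub hm
          simp only [Finset.mem_insert, Finset.mem_singleton] at this
          rcases this with h1 | h1 | h1
          · grind
          · rw [← h1] at hu; grind
          · rw [← h1] at hu; grind)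
  rw [Fintype.card_coe] at hcard
  have : (n : ℤ) ≤ 3 ^ 5 * (G.card : ℤ) := by exact_mod_cast hcol
  linarith

instance : Finite (TriSurface n) :=
  Finite.of_injective TriSurface.faces fun S T h => by cases S; cases T; cases h; rfl

end TriSurface

/-- Barnette–Edelson: for every Euler characteristic `χ ≤ 2` and each orientability
class, there are only finitely many combinatorial isomorphism classes of irreducible
triangulated surfaces with that Euler characteristic and orientability. -/
theorem barnette_edelson_finitely_many_irreducible (χ : ℤ) (hχ : χ ≤ 2) (b : Bool) :
    Finite (Quot (fun A B : {P : Σ n : ℕ, TriSurface n //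
        P.2.eulerChar = χ ∧ (P.2.Orientable ↔ b = true) ∧ P.2.Irreducible} =>
      ∃ σ : Fin A.1.1 ≃ Fin B.1.1,
        ∀ f : Finset (Fin A.1.1), f ∈ A.1.2.faces ↔ f.image σ ∈ B.1.2.faces)) := by
  set N : ℕ := 4 + (3 ^ 5 * (2 - χ)).toNat with hN
  have hbound : ∀ P : {P : Σ n : ℕ, TriSurface n //
      P.2.eulerChar = χ ∧ (P.2.Orientable ↔ b = true) ∧ P.2.Irreducible}, P.1.1 < N + 1 := by
    rintro ⟨⟨n, S⟩, hχS, -, hS⟩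
    rcases Nat.lt_or_ge 4 n with hn | hn
    · have := TriSurface.Irreducible.le_of_four_lt hS hn
      change S.eulerChar = χ at hχS
      rw [hχS] at this
      change n < N + 1
      norm_num at this hN
      omega
    · change n < N + 1
      omega
  have : Finite {P : Σ n : ℕ, TriSurface n //
      P.2.eulerChar = χ ∧ (P.2.Orientable ↔ b = true) ∧ P.2.Irreducible} := by
    refine Finite.of_injective
      (fun P => (⟨⟨P.1.1, hbound P⟩, P.1.2⟩ : Σ k : Fin (N + 1), TriSurface k.1)) ?_
    rintro ⟨⟨n, S⟩, hS⟩ ⟨⟨n', S'⟩, hS'⟩ h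
    simp only [Sigma.mk.injEq, Fin.mk.injEq] at h
    obtain ⟨rfl, h⟩ := h
    simp only [heq_eq_eq] at h
    subst h
    rfl
  exact Quot.finite _
end
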